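/- arXiv:2503.19778 — 5 statements merged into one kernel-verified Lean document; each statement's English description precedes it below -/
import Mathlib

section
/- Let p and q be primes, let P be a finite abelian p-group, and let Q = ⟨α⟩ be a q-subgroup of Aut(P) such that there exists an integer m coprime to p with α(x) = x^m for every x ∈ P. Then in the semidirect product G = P ⋊ Q every independent subset of G is strongly independent. -/
/-- A subset `X` of a group is independent if no element of `X` lies in the
subgroup generated by the other elements of `X`. -/
def Independent {G : Type*} [Group G] (X : Set G) : Prop :=
  ∀ x ∈ X, x ∉ Subgroup.closure (X \ {x})

/-- `dgen H` is the least cardinality of a generating set of the subgroup `H`. -/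
noncomputable def dgen {G : Type*} [Group G] (H : Subgroup G) : ℕ :=
  sInf {n : ℕ | ∃ S : Set G, S.Finite ∧ S ⊆ (H : Set G) ∧ Subgroup.closure S = H ∧ S.ncard = n}

/-- A subset `X` of a group is strongly independent if every subgroup `H` containing `X`
satisfies `|X| ≤ d(H)`. -/
def StronglyIndependent {G : Type*} [Group G] (X : Set G) : Prop :=
  ∀ H : Subgroup G, X ⊆ (H : Set G) → X.ncard ≤ dgen H

/-- A group is hamiltonian if it is nonabelian and all of its subgroups are normal. -/
def IsHamiltonian (G : Type*) [Group G] : Prop :=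
  (∃ a b : G, a * b ≠ b * a) ∧ ∀ H : Subgroup G, H.Normal

namespace AbelianPGroup

variable {P : Type*} [CommGroup P] {p : ℕ}

/-- Adjoining to a subgroup an element whose `p`-th power it contains multiplies the order by
at most `p`. -/
lemma card_sup_zpowers_le [Finite P] (hp : p ≠ 0) (K : Subgroup P) (a : P) (ha : a ^ p ∈ K) :
    Nat.card ↥(K ⊔ Subgroup.zpowers a) ≤ p * Nat.card K := by
  have hp0 : (p : ℤ) ≠ 0 := by exact_mod_cast hp
  let g : Fin p × K → P := fun x => x.2 * a ^ (x.1 : ℕ)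
  have hsub : ((K ⊔ Subgroup.zpowers a : Subgroup P) : Set P) ⊆ Set.range g := by
    intro y hy
    obtain ⟨k, hk, b, hb, rfl⟩ := Subgroup.mem_sup.1 hy
    obtain ⟨j, rfl⟩ := Subgroup.mem_zpowers_iff.1 hb
    have hlt : (j % p).toNat < p := by
      have h1 := Int.emod_nonneg j hp0
      have h2 := Int.emod_lt_of_pos j (by positivity : (0 : ℤ) < p)
      omega
    refine ⟨(⟨(j % p).toNat, hlt⟩, ⟨k * (a ^ p) ^ (j / p), K.mul_mem hk (K.zpow_mem ha _)⟩), ?_⟩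
    have hnat : a ^ (j % p).toNat = a ^ (j % p) := by
      rw [← zpow_natCast, Int.toNat_of_nonneg (Int.emod_nonneg j hp0)]
    change k * (a ^ p) ^ (j / p) * a ^ (j % p).toNat = k * a ^ j
    rw [hnat, ← zpow_natCast, ← zpow_mul, mul_assoc, ← zpow_add, Int.mul_ediv_add_emod]
  calc Nat.card ↥(K ⊔ Subgroup.zpowers a)
      ≤ (Set.range g).ncard := Set.ncard_le_ncard hsub (Set.toFinite _)
    _ ≤ Nat.card (Fin p × K) := by
        rw [← Nat.card_coe_set_eq]; exact Finite.card_range_le g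
    _ = p * Nat.card K := by simp

lemma closure_image_insert {ι : Type*} [DecidableEq ι] (f : ι → P) (s : Finset ι) (i : ι) :
    Subgroup.closure (f '' (insert i s : Finset ι)) =
      Subgroup.closure (f '' s) ⊔ Subgroup.zpowers (f i) := by
  rw [Finset.coe_insert, Set.image_insert_eq, ← Set.union_singleton, Subgroup.closure_union,
    Subgroup.zpowers_eq_closure]

lemma card_sup_closure_le [Finite P] (hp : p ≠ 0) {ι : Type*} (f : ι → P) (D : Subgroup P)
    (s : Finset ι) (hs : ∀ i ∈ s, f i ^ p ∈ D) :
    Nat.card ↥(D ⊔ Subgroup.closure (f '' s)) ≤ p ^ s.card * Nat.card D := by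
  classical
  induction s using Finset.induction_on with
  | empty => simp
  | insert i s hi ih =>
    rw [closure_image_insert, ← sup_assoc, Finset.card_insert_of_notMem hi, pow_succ', mul_assoc]
    refine (card_sup_zpowers_le hp _ _ ?_).trans
      (Nat.mul_le_mul_left _ (ih fun j hj => hs j (Finset.mem_insert_of_mem hj)))
    exact (le_sup_left : D ≤ _) (hs i (Finset.mem_insert_self i s))

lemma mul_card_le_card_of_lt [Finite P] [Fact p.Prime] (hP : IsPGroup p P) {K L : Subgroup P}
    (h : K < L) : p * Nat.card K ≤ Nat.card L := by
  obtain ⟨k, hk⟩ := IsPGroup.iff_card.1 (hP.to_subgroup K)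
  obtain ⟨l, hl⟩ := IsPGroup.iff_card.1 (hP.to_subgroup L)
  have hlt : Nat.card K < Nat.card L :=
    Set.ncard_lt_ncard (s := (K : Set P)) (t := L) h (Set.toFinite _)
  rw [hk, hl] at hlt ⊢
  have hp := (Fact.out : p.Prime)
  have := (Nat.pow_lt_pow_iff_right hp.one_lt).1 hlt
  rw [← pow_succ']
  exact Nat.pow_le_pow_right hp.pos this

lemma pow_mul_card_le_card_sup_closure [Finite P] [Fact p.Prime] (hP : IsPGroup p P)
    {ι : Type*} (f : ι → P) (D : Subgroup P) (s : Finset ι)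
    (hs : ∀ i ∈ s, f i ∉ D ⊔ Subgroup.closure (f '' (s \ {i}))) :
    p ^ s.card * Nat.card D ≤ Nat.card ↥(D ⊔ Subgroup.closure (f '' s)) := by
  classical
  induction s using Finset.induction_on with
  | empty => simp
  | insert i s hi ih =>
    rw [closure_image_insert, ← sup_assoc, Finset.card_insert_of_notMem hi, pow_succ', mul_assoc]
    refine (Nat.mul_le_mul_left _ (ih fun j hj hmem => ?_)).trans (mul_card_le_card_of_lt hP ?_)
    · refine hs j (Finset.mem_insert_of_mem hj) (sup_le_sup_left (Subgroup.closure_mono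
        (Set.image_mono (Set.sdiff_subset_sdiff_left ?_))) D hmem)
      simp
    · refine lt_of_le_of_ne le_sup_left fun heq => hs i (Finset.mem_insert_self i s) ?_
      have hsub : (s : Set ι) ⊆ (insert i s : Finset ι) \ {i} := fun j hj =>
        ⟨Finset.mem_coe.2 (Finset.mem_insert_of_mem hj), fun hji => hi (hji ▸ hj)⟩
      refine sup_le_sup_left (Subgroup.closure_mono (Set.image_mono hsub)) D ?_
      rw [heq]
      exact (le_sup_right : Subgroup.zpowers (f i) ≤ _) (Subgroup.mem_zpowers _)

/-- The subgroup `B ^ p` lies in the Frattini subgroup of `B`. -/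
lemma le_of_le_sup_map_pow [Finite P] [Fact p.Prime] (hP : IsPGroup p P) {B Y : Subgroup P}
    (h : B ≤ Y ⊔ B.map (powMonoidHom p)) : B ≤ Y := by
  have key : ∀ n : ℕ, ∀ b ∈ B, ∃ y ∈ Y, ∃ c ∈ B, b = y * c ^ p ^ n := by
    intro n
    induction n with
    | zero => exact fun b hb => ⟨1, Y.one_mem, b, hb, by simp⟩
    | succ n ih =>
      intro b hb
      obtain ⟨y, hy, c, hc, rfl⟩ := ih b hb
      obtain ⟨y', hy', _, ⟨c', hc', rfl⟩, rfl⟩ := Subgroup.mem_sup.1 (h hc)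
      refine ⟨y * y' ^ p ^ n, Y.mul_mem hy (Y.pow_mem hy' _), c', hc', ?_⟩
      rw [powMonoidHom_apply, mul_pow, ← pow_mul, ← pow_succ', mul_assoc]
  intro b hb
  obtain ⟨n, hn⟩ := IsPGroup.iff_card.1 hP
  obtain ⟨y, hy, c, -, rfl⟩ := key n b hb
  rwa [← hn, pow_card_eq_one', mul_one]

/-- The number of solutions of `x ^ p = 1` in `B`; for a finite abelian `p`-group it is `p` to
the power of the rank of `B`. -/
noncomputable def omegaCard (p : ℕ) (B : Subgroup P) : ℕ :=
  Nat.card ↥(B ⊓ (powMonoidHom p : P →* P).ker)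

lemma omegaCard_mono [Finite P] {A B : Subgroup P} (h : B ≤ A) :
    omegaCard p B ≤ omegaCard p A :=
  Subgroup.card_le_of_le (inf_le_inf_right _ h)

lemma omegaCard_mul_card_map (B : Subgroup P) :
    omegaCard p B * Nat.card (B.map (powMonoidHom p)) = Nat.card B := by
  let F : B →* P := (powMonoidHom p : P →* P).comp B.subtype
  have h1 : Nat.card F.ker = omegaCard p B := by
    rw [omegaCard, inf_comm, ← Subgroup.subgroupOf_map_subtype,
      Subgroup.card_map_of_injective B.subtype_injective]
    rfl
  have h2 : F.range = B.map (powMonoidHom p) := by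
    simp [F, MonoidHom.range_comp]
  rw [← h1, ← h2, ← Subgroup.index_ker, Subgroup.card_mul_index]

lemma omegaCard_le_pow [Finite P] (hp : p ≠ 0) {ι : Type*} (f : ι → P) (B : Subgroup P)
    (s : Finset ι) (hs : ∀ i ∈ s, f i ∈ B)
    (hB : B ≤ B.map (powMonoidHom p) ⊔ Subgroup.closure (f '' s)) :
    omegaCard p B ≤ p ^ s.card := by
  have h1 := card_sup_closure_le hp f (B.map (powMonoidHom p)) s
    fun i hi => ⟨f i, hs i hi, rfl⟩
  refine Nat.le_of_mul_le_mul_right ?_ (Nat.card_pos (α := B.map (powMonoidHom p)))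
  rw [omegaCard_mul_card_map]
  exact (Subgroup.card_le_of_le hB).trans h1

lemma omegaCard_le_pow_succ [Finite P] (hp : p ≠ 0) {ι : Type*} (f : ι → P) (z : P)
    (B : Subgroup P) (s : Finset ι) (hz : z ∈ B) (hs : ∀ i ∈ s, f i ∈ B)
    (hB : B ≤ Subgroup.zpowers z ⊔ Subgroup.closure (f '' s)) :
    omegaCard p B ≤ p ^ (s.card + 1) := by
  have h1 := card_sup_zpowers_le hp (B.map (powMonoidHom p)) z ⟨z, hz, rfl⟩
  have h2 := card_sup_closure_le hp f (B.map (powMonoidHom p) ⊔ Subgroup.zpowers z) s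
    fun i hi => (le_sup_left : B.map (powMonoidHom p) ≤ _) ⟨f i, hs i hi, rfl⟩
  refine Nat.le_of_mul_le_mul_right ?_ (Nat.card_pos (α := B.map (powMonoidHom p)))
  rw [omegaCard_mul_card_map, pow_succ, mul_assoc]
  exact (Subgroup.card_le_of_le (hB.trans (sup_le_sup_right le_sup_right _))).trans
    (h2.trans (Nat.mul_le_mul_left _ h1))

lemma pow_mul_card_le_card [Finite P] [Fact p.Prime] (hP : IsPGroup p P) {ι : Type*} (f : ι → P)
    (Y B : Subgroup P) (s : Finset ι) (hY : Y ⊔ Subgroup.closure (f '' s) = B)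
    (hs : ∀ i ∈ s, f i ∉ Y ⊔ Subgroup.closure (f '' (s \ {i}))) :
    p ^ s.card * Nat.card ↥(Y ⊔ B.map (powMonoidHom p)) ≤ Nat.card B := by
  have hpow : B.map (powMonoidHom p) ≤ B := by
    rintro _ ⟨b, hb, rfl⟩
    exact B.pow_mem hb p
  refine (pow_mul_card_le_card_sup_closure hP f (Y ⊔ B.map (powMonoidHom p)) s ?_).trans
    (Subgroup.card_le_of_le (sup_le (sup_le (hY ▸ le_sup_left) hpow) (hY ▸ le_sup_right)))
  intro i hi hmem
  refine hs i hi ((le_of_le_sup_map_pow hP (B := B) ?_ :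
    B ≤ Y ⊔ Subgroup.closure (f '' (s \ {i}))) ?_)
  · conv_lhs => rw [← hY]
    refine sup_le (le_sup_left.trans le_sup_left) ?_
    rw [Subgroup.closure_le]
    rintro _ ⟨j, hj, rfl⟩
    by_cases hji : j = i
    · subst hji
      rwa [sup_right_comm] at hmem
    · exact (le_sup_right.trans le_sup_left : Subgroup.closure (f '' (s \ {i})) ≤ _)
        (Subgroup.subset_closure ⟨j, ⟨hj, hji⟩, rfl⟩)
  · exact (hY ▸ le_sup_right : Subgroup.closure (f '' s) ≤ B)
      (Subgroup.subset_closure ⟨i, hi, rfl⟩)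

lemma pow_le_omegaCard [Finite P] [Fact p.Prime] (hP : IsPGroup p P) {ι : Type*} (f : ι → P)
    (Y B : Subgroup P) (s : Finset ι) (hY : Y ⊔ Subgroup.closure (f '' s) = B)
    (hs : ∀ i ∈ s, f i ∉ Y ⊔ Subgroup.closure (f '' (s \ {i}))) :
    p ^ s.card ≤ omegaCard p B := by
  refine Nat.le_of_mul_le_mul_right ?_ (Nat.card_pos (α := B.map (powMonoidHom p)))
  rw [omegaCard_mul_card_map]
  exact (Nat.mul_le_mul_left _ (Subgroup.card_le_of_le le_sup_right)).trans
    (pow_mul_card_le_card hP f Y B s hY hs)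

lemma pow_succ_le_omegaCard [Finite P] [Fact p.Prime] (hP : IsPGroup p P) {ι : Type*}
    (f : ι → P) (Y B : Subgroup P) (s : Finset ι) (hY : Y ⊔ Subgroup.closure (f '' s) = B)
    (hs : ∀ i ∈ s, f i ∉ Y ⊔ Subgroup.closure (f '' (s \ {i})))
    (hYB : ¬ Y ≤ B.map (powMonoidHom p)) :
    p ^ (s.card + 1) ≤ omegaCard p B := by
  refine Nat.le_of_mul_le_mul_right ?_ (Nat.card_pos (α := B.map (powMonoidHom p)))
  rw [omegaCard_mul_card_map, pow_succ, mul_assoc]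
  exact (Nat.mul_le_mul_left _ (mul_card_le_card_of_lt hP (right_lt_sup.2 hYB))).trans
    (pow_mul_card_le_card hP f Y B s hY hs)

end AbelianPGroup

/-- In a finite cyclic group of prime power order, every nonempty set contains an element
generating the same subgroup as the set. -/
lemma exists_forall_mem_zpowers_of_isPGroup {Q : Type*} [Group Q] [Finite Q] [IsCyclic Q] {q : ℕ}
    [Fact q.Prime] (hQ : IsPGroup q Q) {S : Set Q} (hS : S.Nonempty) :
    ∃ s ∈ S, ∀ y ∈ S, y ∈ Subgroup.zpowers s := by
  classical
  have := Fintype.ofFinite Q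
  obtain ⟨s, hs, hmax⟩ := S.toFinite.exists_maximalFor orderOf S hS
  refine ⟨s, hs, fun y hy => ?_⟩
  have hdvd : orderOf y ∣ orderOf s := by
    obtain ⟨k, hk⟩ := IsPGroup.iff_orderOf.1 hQ y
    obtain ⟨l, hl⟩ := IsPGroup.iff_orderOf.1 hQ s
    have hq := (Fact.out : q.Prime)
    rw [hk, hl]
    by_contra hnot
    have hlt : l < k := by
      by_contra hkl
      exact hnot (pow_dvd_pow q (not_lt.1 hkl))
    have h1 : orderOf s < orderOf y := by
      rw [hk, hl]
      exact Nat.pow_lt_pow_right hq.one_lt hlt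
    exact absurd (hmax hy h1.le) (not_le.2 h1)
  have hsub : (Subgroup.zpowers s : Set Q).toFinset ⊆
      (Finset.univ.filter fun a : Q => a ^ orderOf s = 1) := by
    intro a ha
    rw [Set.mem_toFinset] at ha
    simpa using orderOf_dvd_iff_pow_eq_one.1 (orderOf_dvd_of_mem_zpowers ha)
  have heq := Finset.eq_of_subset_of_card_le hsub (by
    refine (IsCyclic.card_pow_eq_one_le (orderOf_pos s)).trans ?_
    rw [Set.toFinset_card]
    exact (Fintype.card_zpowers (x := s)).ge)
  have hmem : y ∈ (Finset.univ.filter fun a : Q => a ^ orderOf s = 1) := by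
    simpa using orderOf_dvd_iff_pow_eq_one.1 hdvd
  rw [← heq, Set.mem_toFinset] at hmem
  exact hmem

namespace PowerExtension

open Subgroup AbelianPGroup

variable {G Q P : Type*} [Group G] [Group Q] [CommGroup P] {ι : P →* G} {π : G →* Q} {p : ℕ}

lemma conj_pow_of_conj {g : G} {n : ℤ} (hg : ∀ y, g * ι y * g⁻¹ = ι (y ^ n)) (j : ℕ) (y : P) :
    g ^ j * ι y * (g ^ j)⁻¹ = ι (y ^ n ^ j) := by
  induction j with
  | zero => simp
  | succ j ih =>
    calc g ^ (j + 1) * ι y * (g ^ (j + 1))⁻¹ = g * (g ^ j * ι y * (g ^ j)⁻¹) * g⁻¹ := by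
          rw [pow_succ']; group
      _ = ι (y ^ n ^ (j + 1)) := by rw [ih, hg, ← zpow_mul, pow_succ]

lemma mul_pow_of_conj {g : G} {n : ℤ} (hg : ∀ y, g * ι y * g⁻¹ = ι (y ^ n)) (a : P) (u : ℕ) :
    (ι a * g) ^ u = ι (a ^ ∑ i ∈ Finset.range u, n ^ i) * g ^ u := by
  induction u with
  | zero => simp
  | succ u ih =>
    have h := hg (a ^ ∑ i ∈ Finset.range u, n ^ i)
    calc (ι a * g) ^ (u + 1)
        = ι a * (g * ι (a ^ ∑ i ∈ Finset.range u, n ^ i) * g⁻¹) * g ^ (u + 1) := by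
          rw [pow_succ', ih, pow_succ' g]; group
      _ = ι (a ^ ∑ i ∈ Finset.range (u + 1), n ^ i) * g ^ (u + 1) := by
          rw [h, ← map_mul, ← zpow_mul, ← zpow_one_add, geom_sum_succ]
          congr 3; ring

lemma normal_map (hact : ∀ g : G, ∃ n : ℤ, ∀ y, g * ι y * g⁻¹ = ι (y ^ n)) (B : Subgroup P) :
    (B.map ι).Normal := by
  refine ⟨?_⟩
  rintro _ ⟨b, hb, rfl⟩ g
  obtain ⟨n, hn⟩ := hact g
  exact ⟨b ^ n, B.zpow_mem hb n, (hn b).symm⟩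

lemma comap_closure_insert (hι : Function.Injective ι) (hker : ι.range = π.ker)
    (hact : ∀ g : G, ∃ n : ℤ, ∀ y, g * ι y * g⁻¹ = ι (y ^ n)) {x : G} {z : P}
    (hz : ι z = x ^ orderOf (π x)) (T : Set P) :
    (closure (insert x (ι '' T))).comap ι = zpowers z ⊔ closure T := by
  have hN := normal_map hact (closure T)
  have hcl : closure (insert x (ι '' T)) = zpowers x ⊔ (closure T).map ι := by
    rw [Set.insert_eq, Subgroup.closure_union, zpowers_eq_closure, MonoidHom.map_closure]
  rw [hcl]
  apply le_antisymm
  · intro y hy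
    obtain ⟨_, ⟨j, rfl⟩, _, ⟨b, hb, rfl⟩, hab⟩ := mem_sup_of_normal_right.1 (mem_comap.1 hy)
    have hπ : ∀ a, π (ι a) = 1 := fun a => MonoidHom.mem_ker.1 (hker ▸ ⟨a, rfl⟩)
    have hj : π x ^ j = 1 := by simpa [hπ] using congrArg π hab
    obtain ⟨c, rfl⟩ := orderOf_dvd_iff_zpow_eq_one.2 hj
    have : y = z ^ c * b := hι <| by
      rw [← hab, map_mul, map_zpow, hz, ← zpow_natCast, ← zpow_mul]
    rw [this]
    exact mul_mem_sup (zpow_mem_zpowers z c) hb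
  · refine sup_le ?_ (map_le_iff_le_comap.1 le_sup_right)
    rw [zpowers_le, mem_comap, hz]
    exact (le_sup_left : zpowers x ≤ _) (npow_mem_zpowers x _)

lemma closure_insert_eq {x : G} {Y : Set G} {f : G → P}
    (hf : ∀ y ∈ Y, ∃ k : ℤ, ι (f y) = y * x ^ k) :
    closure (insert x Y) = closure (insert x (ι '' (f '' Y))) := by
  apply le_antisymm <;> rw [closure_le] <;> rintro y (rfl | hy)
  · exact subset_closure (Set.mem_insert _ _)
  · obtain ⟨k, hk⟩ := hf y hy
    rw [eq_mul_inv_of_mul_eq hk.symm]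
    exact mul_mem (subset_closure (Or.inr ⟨_, ⟨y, hy, rfl⟩, rfl⟩))
      (inv_mem (zpow_mem (subset_closure (Set.mem_insert _ _)) k))
  · exact subset_closure (Set.mem_insert _ _)
  · obtain ⟨_, ⟨y, hy, rfl⟩, rfl⟩ := hy
    obtain ⟨k, hk⟩ := hf y hy
    rw [hk]
    exact mul_mem (subset_closure (Or.inr hy))
      (zpow_mem (subset_closure (Set.mem_insert _ _)) k)

/-- If the image of `s` generates the image of `S`, then modulo powers of `s` the elements of `S`
may be moved into the kernel. -/
lemma exists_kernel_generators (hι : Function.Injective ι) (hker : ι.range = π.ker)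
    (hact : ∀ g : G, ∃ n : ℤ, ∀ y, g * ι y * g⁻¹ = ι (y ^ n)) {S : Set G} {s : G}
    (hs : ∀ y ∈ S, π y ∈ zpowers (π s)) :
    ∃ (f : G → P) (z : P), ι z = s ^ orderOf (π s) ∧
      (∀ y ∈ S, ∃ k : ℤ, ι (f y) = y * s ^ k) ∧
      ∀ T ⊆ S, (closure (insert s T)).comap ι = zpowers z ⊔ closure (f '' T) := by
  have hlift : ∀ g, π g = 1 → ∃ a, ι a = g := fun g hg => by
    have : g ∈ ι.range := hker ▸ MonoidHom.mem_ker.2 hg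
    exact this
  obtain ⟨z, hz⟩ := hlift (s ^ orderOf (π s)) (by rw [map_pow, pow_orderOf_eq_one])
  have hex : ∀ y, ∃ a, y ∈ S → ∃ k : ℤ, ι a = y * s ^ k := by
    intro y
    by_cases hy : y ∈ S
    · obtain ⟨k, hk⟩ := mem_zpowers_iff.1 (hs y hy)
      obtain ⟨a, ha⟩ := hlift (y * s ^ (-k)) (by simp [← hk])
      exact ⟨a, fun _ => ⟨-k, ha⟩⟩
    · exact ⟨1, fun h => absurd h hy⟩
  choose f hf using hex
  refine ⟨f, z, hz, hf, fun T hT => ?_⟩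
  rw [closure_insert_eq fun y hy => hf y (hT hy), comap_closure_insert hι hker hact hz]

/-- Membership of the kernel part `s ^ orderOf (π s)` in the `p`-th powers is detected on
any element outside the kernel. -/
lemma mem_map_pow_of_mem_map_pow [Finite P] [Fact p.Prime] (hP : IsPGroup p P)
    (hι : Function.Injective ι)
    (hact : ∀ g : G, ∃ n : ℤ, ∀ y, g * ι y * g⁻¹ = ι (y ^ n))
    (hfaith : ∀ g : G, (∀ y, g * ι y * g⁻¹ = ι y) → π g = 1) (hπι : ∀ a, π (ι a) = 1)
    {A : Subgroup P} {s x : G} {a z w : P} {j : ℕ} (ha : a ∈ A) (hzA : z ∈ A)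
    (hx : x = ι a * s ^ j) (hπx : π x ≠ 1)
    (hz : ι z = s ^ orderOf (π s)) (hw : ι w = x ^ orderOf (π x))
    (hwA : w ∈ A.map (powMonoidHom p)) : z ∈ A.map (powMonoidHom p) := by
  have hp := (Fact.out : p.Prime)
  obtain ⟨n, hn⟩ := hact s
  have hmap_pow : ∀ b ∈ A, b ^ p ∈ A.map (powMonoidHom p) := fun b hb => ⟨b, hb, rfl⟩
  have hmap_zpow : ∀ b ∈ A, ∀ N : ℤ, (p : ℤ) ∣ N → b ^ N ∈ A.map (powMonoidHom p) := by
    rintro b hb _ ⟨c, rfl⟩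
    rw [zpow_mul, zpow_natCast]
    exact zpow_mem (hmap_pow b hb) c
  by_cases hnp : (p : ℤ) ∣ n - 1
  · have hπs : ∃ e, orderOf (π s) ∣ p ^ e := by
      obtain ⟨e, he⟩ := IsPGroup.iff_card.1 hP
      refine ⟨e, orderOf_dvd_iff_pow_eq_one.2 ?_⟩
      rw [← map_pow]
      refine hfaith _ fun y => ?_
      rw [conj_pow_of_conj hn]
      congr 1
      have h1 : (p : ℤ) ^ (e + 1) ∣ n ^ p ^ e - 1 ^ p ^ e := dvd_sub_pow_of_dvd_sub hnp e
      obtain ⟨c, hc⟩ := h1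
      have h2 : n ^ p ^ e = 1 + (p ^ e : ℕ) * (p * c) := by
        rw [one_pow] at hc
        push_cast
        linear_combination hc
      rw [h2, zpow_add, zpow_mul, zpow_natCast, ← he, pow_card_eq_one', one_zpow, mul_one,
        zpow_one]
    obtain ⟨e, he⟩ := hπs
    set t := orderOf (π s) with ht
    have htpos : 0 < t := Nat.pos_of_dvd_of_pos he (pow_pos hp.pos e)
    have hπxs : π x = π s ^ j := by rw [hx, map_mul, hπι, one_mul, map_pow]
    have hu : orderOf (π x) = t / t.gcd j := by
      rw [hπxs, orderOf_pow' (π s) (fun h0 => hπx (by rw [hπxs, h0, pow_zero]))]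
    set u := orderOf (π x) with hu'
    have hgpos : 0 < t.gcd j := Nat.gcd_pos_of_pos_left j htpos
    have hcop : Nat.Coprime u (j / t.gcd j) := hu ▸ Nat.coprime_div_gcd_div_gcd hgpos
    have hju : j * u = t * (j / t.gcd j) := by
      rw [hu]
      obtain ⟨t', ht'⟩ := Nat.gcd_dvd_left t j
      obtain ⟨j', hj'⟩ := Nat.gcd_dvd_right t j
      have e1 : t / t.gcd j = t' := Nat.div_eq_of_eq_mul_right hgpos ht'
      have e2 : j / t.gcd j = j' := Nat.div_eq_of_eq_mul_right hgpos hj'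
      rw [e1, e2]
      calc j * t' = t.gcd j * j' * t' := by rw [← hj']
        _ = t.gcd j * t' * j' := by ring
        _ = t * j' := by rw [← ht']
    have hpu : p ∣ u := by
      have hudvd : u ∣ p ^ e :=
        (hu ▸ Nat.div_dvd_of_dvd (Nat.gcd_dvd_left t j) : u ∣ t).trans he
      obtain ⟨l, -, hl⟩ := (Nat.dvd_prime_pow hp).1 hudvd
      rw [hl]
      refine dvd_pow_self p fun hl0 => hπx ?_
      rw [hl0, pow_zero] at hl
      exact orderOf_eq_one_iff.1 hl
    set c := j / t.gcd j with hc
    have hcp : Nat.Coprime p c := Nat.Coprime.coprime_dvd_left hpu hcop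
    have hw' : w = a ^ (∑ i ∈ Finset.range u, (n ^ j) ^ i) * z ^ c := hι <| by
      rw [hw, hx, mul_pow_of_conj (conj_pow_of_conj hn j), map_mul, map_pow ι z, hz, ← pow_mul,
        ← pow_mul, hju]
    have hN : (p : ℤ) ∣ ∑ i ∈ Finset.range u, (n ^ j) ^ i := by
      have hmod : ∑ i ∈ Finset.range u, (n ^ j) ^ i ≡ ∑ i ∈ Finset.range u, 1 [ZMOD p] := by
        refine Int.ModEq.sum fun i _ => ?_
        have h1 : n ≡ 1 [ZMOD p] := (Int.modEq_iff_dvd.2 hnp).symm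
        simpa using (h1.pow j).pow i
      refine (hmod.dvd_iff).2 ?_
      simpa using Int.natCast_dvd_natCast.2 hpu
    have hzc : z ^ c ∈ A.map (powMonoidHom p) := by
      have h := mul_mem (inv_mem (hmap_zpow a ha _ hN)) hwA
      rwa [hw', inv_mul_cancel_left] at h
    have hbez : (z ^ p) ^ p.gcdA c * (z ^ c) ^ p.gcdB c = z := by
      have h := Nat.gcd_eq_gcd_ab p c
      rw [hcp.gcd_eq_one] at h
      rw [← zpow_natCast, ← zpow_natCast, ← zpow_mul, ← zpow_mul, ← zpow_add, ← h]
      simp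
    rw [← hbez]
    exact mul_mem (zpow_mem (hmap_pow z hzA) _) (zpow_mem hzc _)
  · have hzn : z ^ (n - 1) = 1 := by
      have h1 : z ^ n = z := hι <| by
        rw [← hn z, hz]
        group
      rw [zpow_sub, h1, zpow_one, mul_inv_cancel]
    obtain ⟨k, hk⟩ := IsPGroup.iff_orderOf.1 hP z
    have hz1 : z = 1 := by
      rw [← orderOf_eq_one_iff, hk]
      rcases Nat.eq_zero_or_pos k with rfl | hkpos
      · simp
      · refine absurd ?_ hnp
        have h2 := orderOf_dvd_iff_zpow_eq_one.2 hzn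
        rw [hk] at h2
        exact (Int.natCast_dvd_natCast.2 (dvd_pow_self p hkpos.ne')).trans h2
    rw [hz1]
    exact one_mem _

lemma card_le_card_of_independent [Finite G] [Finite P] [Fact p.Prime] (hP : IsPGroup p P)
    (hι : Function.Injective ι) (hker : ι.range = π.ker)
    (hact : ∀ g : G, ∃ n : ℤ, ∀ y, g * ι y * g⁻¹ = ι (y ^ n))
    (hfaith : ∀ g : G, (∀ y, g * ι y * g⁻¹ = ι y) → π g = 1)
    (hgen : ∀ S : Set G, S.Nonempty → ∃ s ∈ S, ∀ y ∈ S, π y ∈ zpowers (π s))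
    {S X : Finset G} (hX : Independent (X : Set G))
    (hXS : closure (X : Set G) ≤ closure (S : Set G)) : X.card ≤ S.card := by
  classical
  have hp := (Fact.out : p.Prime)
  have hπι : ∀ a, π (ι a) = 1 := fun a => MonoidHom.mem_ker.1 (hker ▸ ⟨a, rfl⟩)
  rcases X.eq_empty_or_nonempty with rfl | hXne
  · simp
  rcases S.eq_empty_or_nonempty with rfl | hSne
  · obtain ⟨x, hx⟩ := hXne
    have h1 : x = 1 := by simpa using hXS (subset_closure hx)
    exact absurd (h1 ▸ one_mem _) (hX x hx)
  obtain ⟨s, hsS, hs⟩ := hgen S hSne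
  obtain ⟨x, hxX, hx⟩ := hgen X hXne
  obtain ⟨f, z, hz, hf, hfcl⟩ := exists_kernel_generators hι hker hact hs
  obtain ⟨g, w, hw, hg, hgcl⟩ := exists_kernel_generators hι hker hact hx
  set A := (closure (S : Set G)).comap ι with hA
  set B := (closure (X : Set G)).comap ι with hB
  have hBA : B ≤ A := comap_mono hXS
  have hρ : omegaCard p B ≤ omegaCard p A := omegaCard_mono hBA
  have herase : ∀ (Y : Finset G) (y : G), y ∈ Y → insert y ((Y.erase y : Finset G) : Set G) = Y :=
    fun Y y hy => by rw [← Finset.coe_insert, Finset.insert_erase hy]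
  have hA' : zpowers z ⊔ closure (f '' (S.erase s : Finset G)) = A := by
    rw [← hfcl _ (Finset.coe_subset.2 (Finset.erase_subset s S)), herase S s hsS]
  have hB' : zpowers w ⊔ closure (g '' (X.erase x : Finset G)) = B := by
    rw [← hgcl _ (Finset.coe_subset.2 (Finset.erase_subset x X)), herase X x hxX]
  have hzA : z ∈ A := hA' ▸ (le_sup_left : zpowers z ≤ _) (mem_zpowers z)
  have hfA : ∀ i ∈ S.erase s, f i ∈ A := fun i hi =>
    (hA' ▸ le_sup_right : closure (f '' (S.erase s : Finset G)) ≤ A) (subset_closure ⟨i, hi, rfl⟩)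
  have hScard := Finset.card_erase_add_one hsS
  have hXcard := Finset.card_erase_add_one hxX
  have hAupper : omegaCard p A ≤ p ^ S.card := by
    rw [← hScard]
    exact omegaCard_le_pow_succ hp.ne_zero f z A _ hzA hfA hA'.ge
  have hindep : ∀ i ∈ X.erase x,
      g i ∉ zpowers w ⊔ closure (g '' ((X.erase x : Finset G) \ {i})) := by
    intro i hi hmem
    have hsub : ((X.erase x : Finset G) : Set G) \ {i} ⊆ X :=
      Set.sdiff_subset.trans (Finset.coe_subset.2 (Finset.erase_subset x X))
    rw [← hgcl _ hsub, mem_comap] at hmem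
    have hiX := Finset.mem_of_mem_erase hi
    obtain ⟨k, hk⟩ := hg i hiX
    have hxi : x ∈ (X : Set G) \ {i} := ⟨hxX, fun h => Finset.ne_of_mem_erase hi h.symm⟩
    have hle : closure (insert x (((X.erase x : Finset G) : Set G) \ {i})) ≤
        closure ((X : Set G) \ {i}) :=
      closure_mono (Set.insert_subset hxi fun y hy => ⟨hsub hy, hy.2⟩)
    refine hX i hiX ?_
    have := mul_mem (hle hmem) (inv_mem (zpow_mem (subset_closure hxi) k))
    rwa [hk, mul_inv_cancel_right] at this
  by_cases hπx : π x = 1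
  · have hX1 : ∀ y ∈ X, π y = 1 := fun y hy => by simpa [hπx] using hx y hy
    have hex : ∀ y, ∃ a, y ∈ X → ι a = y := fun y => by
      by_cases hy : y ∈ X
      · have : y ∈ ι.range := hker ▸ MonoidHom.mem_ker.2 (hX1 y hy)
        exact this.imp fun a ha _ => ha
      · exact ⟨1, fun h => absurd h hy⟩
    choose h hh using hex
    have himage : ∀ Y ⊆ (X : Set G), (closure (h '' Y)).map ι = closure Y := fun Y hY => by
      rw [MonoidHom.map_closure, Set.image_image, Set.image_congr fun y hy => hh y (hY hy),
        Set.image_id']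
    have hle : closure (h '' X) ≤ A :=
      (map_le_iff_le_comap.1 (himage X subset_rfl).le).trans hBA
    have hlow := pow_le_omegaCard hP h ⊥ (closure (h '' X)) X (bot_sup_eq _) fun i hi hmem => by
      rw [bot_sup_eq] at hmem
      refine hX i hi ?_
      rw [← himage _ Set.sdiff_subset]
      exact ⟨h i, hmem, hh i hi⟩
    exact (Nat.pow_le_pow_iff_right hp.one_lt).1
      (hlow.trans ((omegaCard_mono hle).trans hAupper))
  by_cases hwB : w ∈ B.map (powMonoidHom p)
  · have hlow := pow_le_omegaCard hP g (zpowers w) B _ hB' hindep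
    have hxS : x ∈ closure (S : Set G) := hXS (subset_closure hxX)
    have hxs : π x ∈ zpowers (π s) := by
      have : closure (S : Set G) ≤ (zpowers (π s)).comap π := (closure_le _).2 hs
      exact this hxS
    obtain ⟨j, hj⟩ : ∃ j : ℕ, π s ^ j = π x := by
      obtain ⟨k, hk⟩ := mem_zpowers_iff.1 hxs
      obtain ⟨j, hj⟩ := mem_powers_iff_mem_zpowers.2 (⟨k, rfl⟩ : s ^ k ∈ zpowers s)
      exact ⟨j, by rw [← hk, ← map_zpow, ← map_pow]; exact congrArg π hj⟩
    obtain ⟨a, ha⟩ : x * (s ^ j)⁻¹ ∈ ι.range := hker ▸ MonoidHom.mem_ker.2 (by simp [hj])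
    have haA : a ∈ A := by
      rw [hA, mem_comap, ha]
      exact mul_mem hxS (inv_mem (pow_mem (subset_closure hsS) j))
    have hzpow := mem_map_pow_of_mem_map_pow hP hι hact hfaith hπι haA hzA
      (by rw [ha, inv_mul_cancel_right]) hπx hz hw (map_mono hBA hwB)
    have hup := omegaCard_le_pow hp.ne_zero f A _ hfA (by
      conv_lhs => rw [← hA']
      exact sup_le_sup_right (zpowers_le.2 hzpow) _)
    have := (Nat.pow_le_pow_iff_right hp.one_lt).1 (hlow.trans (hρ.trans hup))
    omega
  · have hlow := pow_succ_le_omegaCard hP g (zpowers w) B _ hB' hindep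
      (by rwa [zpowers_le])
    rw [hXcard] at hlow
    exact (Nat.pow_le_pow_iff_right hp.one_lt).1 (hlow.trans (hρ.trans hAupper))

lemma stronglyIndependent_of_independent [Finite G] [Finite P] [Fact p.Prime] (hP : IsPGroup p P)
    (hι : Function.Injective ι) (hker : ι.range = π.ker)
    (hact : ∀ g : G, ∃ n : ℤ, ∀ y, g * ι y * g⁻¹ = ι (y ^ n))
    (hfaith : ∀ g : G, (∀ y, g * ι y * g⁻¹ = ι y) → π g = 1)
    (hgen : ∀ S : Set G, S.Nonempty → ∃ s ∈ S, ∀ y ∈ S, π y ∈ zpowers (π s))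
    {X : Set G} (hX : Independent X) : StronglyIndependent X := by
  intro H hXH
  obtain ⟨S, hSfin, -, hScl, hScard⟩ : dgen H ∈ {n : ℕ | ∃ S : Set G,
      S.Finite ∧ S ⊆ (H : Set G) ∧ closure S = H ∧ S.ncard = n} :=
    Nat.sInf_mem ⟨_, (H : Set G), Set.toFinite _, subset_rfl, closure_eq H, rfl⟩
  lift S to Finset G using hSfin
  lift X to Finset G using X.toFinite
  rw [← hScard, Set.ncard_coe_finset, Set.ncard_coe_finset]
  exact card_le_card_of_independent hP hι hker hact hfaith hgen hX
    (hScl ▸ (closure_le H).2 hXH)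

end PowerExtension

theorem semidirect_power_action_indep_eq_strong_indep
    (p q : ℕ) (hp : p.Prime) (hq : q.Prime)
    (P : Type) [CommGroup P] [Finite P] (hP : IsPGroup p P)
    (α : MulAut P) (hα : IsPGroup q ↥(Subgroup.zpowers α))
    (m : ℤ) (hm : Int.gcd m p = 1) (hpow : ∀ x : P, α x = x ^ m) :
    ∀ X : Set (P ⋊[(Subgroup.zpowers α).subtype] ↥(Subgroup.zpowers α)),
      Independent X → StronglyIndependent X := by
  intro X hX
  have := Fact.mk hp
  have := Fact.mk hq
  have : Finite (MulAut P) := Finite.of_injective _ (DFunLike.coe_injective (F := MulAut P))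
  have : Finite (P ⋊[(Subgroup.zpowers α).subtype] ↥(Subgroup.zpowers α)) :=
    Finite.of_equiv _ SemidirectProduct.equivProd.symm
  have hconj : ∀ (g : P ⋊[(Subgroup.zpowers α).subtype] ↥(Subgroup.zpowers α)) (y : P),
      g * SemidirectProduct.inl y * g⁻¹ = SemidirectProduct.inl ((g.right : MulAut P) y) := by
    intro g y
    ext
    · simp [mul_comm, mul_left_comm]
    · simp
  refine PowerExtension.stronglyIndependent_of_independent hP (ι := SemidirectProduct.inl)
    (π := SemidirectProduct.rightHom) SemidirectProduct.inl_injective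
    SemidirectProduct.range_inl_eq_ker_rightHom (fun g => ?_) (fun g hg => ?_)
    (fun S hS => ?_) hX
  · obtain ⟨i, hi⟩ := mem_powers_iff_mem_zpowers.2 g.right.2
    refine ⟨m ^ i, fun y => ?_⟩
    have hpow_iter : ∀ i : ℕ, (α ^ i) y = y ^ m ^ i := by
      intro i
      induction i with
      | zero => simp
      | succ i ih => rw [pow_succ', MulAut.mul_apply, ih, hpow, ← zpow_mul, pow_succ]
    rw [hconj, ← hi]
    exact congrArg _ (hpow_iter i)
  · refine Subtype.ext (MulEquiv.ext fun y => ?_)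
    exact SemidirectProduct.inl_injective ((hconj g y).symm.trans (hg y))
  · obtain ⟨_, ⟨s, hs, rfl⟩, h⟩ := exists_forall_mem_zpowers_of_isPGroup hα
      (hS.image SemidirectProduct.rightHom)
    exact ⟨s, hs, fun y hy => h _ ⟨y, hy, rfl⟩⟩
end

section
/- Let G and H be finite groups with H nilpotent. Then: (1) if the independence complexes Σ(G) and Σ(H) are isomorphic, then G is nilpotent; (2) if the strong independence complexes Σ̃(G) and Σ̃(H) are isomorphic, then G is nilpotent; (3) if G and H have the same order and their subgroup lattices are isomorphic as lattices, then G is nilpotent. -/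
open Subgroup

/-- Two elements are adjacent in the power graph if one is a power of the other. -/
def PowerAdj {G : Type*} [Group G] (x y : G) : Prop :=
  x ∈ zpowers y ∨ y ∈ zpowers x

/-- Two elements are adjacent in the enhanced power graph if they lie in a common cyclic
subgroup. -/
def CyclicAdj {G : Type*} [Group G] (x y : G) : Prop :=
  ∃ z, x ∈ zpowers z ∧ y ∈ zpowers z

/-- The nontrivial elements with the same closed neighbourhood as `x` in the power graph. -/
def powerTwins {G : Type*} [Group G] (x : G) : Set G :=
  {w | w ≠ 1 ∧ ∀ t, PowerAdj w t ↔ PowerAdj x t}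

section PowerGraph

variable {G : Type*} [Group G]

lemma PowerAdj.symm {x y : G} (h : PowerAdj x y) : PowerAdj y x := Or.symm h

lemma PowerAdj.cyclicAdj {x y : G} (h : PowerAdj x y) : CyclicAdj x y := by
  rcases h with h | h
  · exact ⟨y, h, mem_zpowers y⟩
  · exact ⟨x, mem_zpowers x, h⟩

lemma mem_zpowers_trans {x y z : G} (h : x ∈ zpowers y) (h' : y ∈ zpowers z) :
    x ∈ zpowers z :=
  zpowers_le.2 h' h

lemma ncard_torsion_of_isCyclic [Finite G] (K : Subgroup G) (hK : IsCyclic K) (n : ℕ) :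
    {x : G | x ∈ K ∧ x ^ n = 1}.ncard = (Nat.card K).gcd n := by
  let _ : CommGroup K := hK.commGroup
  rw [← IsCyclic.card_powMonoidHom_ker (G := K) n, ← Nat.card_coe_set_eq]
  refine Nat.card_congr
    ⟨fun x => ⟨⟨x.1, x.2.1⟩, ?_⟩, fun x => ⟨x.1.1, x.1.2, ?_⟩, fun x => rfl, fun x => rfl⟩
  · rw [MonoidHom.mem_ker]
    exact Subtype.ext x.2.2
  · exact congrArg Subtype.val (MonoidHom.mem_ker.1 x.2)

lemma mem_zpowers_of_orderOf_dvd [Finite G] {x y z : G} (hx : x ∈ zpowers z)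
    (hy : y ∈ zpowers z) (h : orderOf x ∣ orderOf y) : x ∈ zpowers y := by
  have hsub : (zpowers y : Set G) ⊆ {g : G | g ∈ zpowers z ∧ g ^ orderOf y = 1} := fun g hg =>
    ⟨mem_zpowers_trans hg hy, orderOf_dvd_iff_pow_eq_one.1 (orderOf_dvd_of_mem_zpowers hg)⟩
  have hcard := ncard_torsion_of_isCyclic (zpowers z) inferInstance (orderOf y)
  rw [Nat.card_zpowers, Nat.gcd_eq_right (orderOf_dvd_of_mem_zpowers hy)] at hcard
  have heq := Set.eq_of_subset_of_ncard_le hsub (by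
    rw [hcard, ← Nat.card_coe_set_eq]
    exact (Nat.card_zpowers y).ge) (Set.toFinite _)
  have hmem : x ∈ {g : G | g ∈ zpowers z ∧ g ^ orderOf y = 1} :=
    ⟨hx, orderOf_dvd_iff_pow_eq_one.1 h⟩
  rw [← heq] at hmem
  exact hmem

lemma powerAdj_iff_orderOf_dvd [Finite G] {x y z : G} (hx : x ∈ zpowers z)
    (hy : y ∈ zpowers z) : PowerAdj x y ↔ orderOf x ∣ orderOf y ∨ orderOf y ∣ orderOf x :=
  ⟨Or.imp orderOf_dvd_of_mem_zpowers orderOf_dvd_of_mem_zpowers,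
    Or.imp (mem_zpowers_of_orderOf_dvd hx hy) (mem_zpowers_of_orderOf_dvd hy hx)⟩

lemma exists_mem_zpowers_orderOf_eq [Finite G] (z : G) {d : ℕ} (h : d ∣ orderOf z) :
    ∃ x ∈ zpowers z, orderOf x = d := by
  obtain ⟨e, he⟩ := h
  refine ⟨z ^ e, pow_mem (mem_zpowers z) e, ?_⟩
  have hpos := orderOf_pos z
  have he0 : e ≠ 0 := by
    rintro rfl
    simp only [mul_zero] at he
    omega
  rw [orderOf_pow_of_dvd he0 ⟨d, by rw [he, mul_comm]⟩, he,
    Nat.mul_div_cancel _ (Nat.pos_of_ne_zero he0)]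

lemma zpowers_eq_iff_orderOf_eq [Finite G] {x z : G} (hx : x ∈ zpowers z) :
    zpowers x = zpowers z ↔ orderOf x = orderOf z := by
  constructor
  · intro h
    rw [← Nat.card_zpowers, h, Nat.card_zpowers]
  · intro h
    exact le_antisymm (zpowers_le.2 hx)
      (zpowers_le.2 (mem_zpowers_of_orderOf_dvd (mem_zpowers z) hx h.symm.dvd))

lemma ncard_generators [Finite G] (z : G) :
    {w : G | zpowers w = zpowers z}.ncard = (orderOf z).totient := by
  classical
  have := Fintype.ofFinite G
  have hd : orderOf z ∣ Fintype.card (zpowers z) := by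
    rw [← Nat.card_eq_fintype_card, Nat.card_zpowers]
  rw [← IsCyclic.card_orderOf_eq_totient hd, ← Set.ncard_coe_finset,
    ← Set.ncard_image_of_injective _ Subtype.val_injective]
  congr 1
  ext w
  simp only [Set.mem_ofPred_eq, Finset.coe_filter, Finset.mem_univ, true_and, Set.mem_image,
    Subtype.exists, exists_and_right, exists_eq_right, orderOf_mk]
  constructor
  · intro h
    have hw : w ∈ zpowers z := h ▸ mem_zpowers w
    exact ⟨hw, (zpowers_eq_iff_orderOf_eq hw).1 h⟩
  · rintro ⟨hw, h⟩
    exact (zpowers_eq_iff_orderOf_eq hw).2 h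

/-- If comparability under divisibility with `d` and with a proper multiple `e` of `d` agree on the
divisors of `n`, then `n` is a prime power. -/
lemma exists_prime_pow_of_comparable {d e n : ℕ} (hn : n ≠ 0) (hd : d ≠ 1) (hde : d ∣ e)
    (hne : d ≠ e) (hen : e ∣ n)
    (h : ∀ f, f ∣ n → ((f ∣ d ∨ d ∣ f) ↔ (f ∣ e ∨ e ∣ f))) :
    ∃ p k, p.Prime ∧ n = p ^ k := by
  have he0 : e ≠ 0 := ne_zero_of_dvd_ne_zero hn hen
  have hd0 : d ≠ 0 := ne_zero_of_dvd_ne_zero he0 hde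
  obtain ⟨p, hp, hlt⟩ : ∃ p, p.Prime ∧ d.factorization p < e.factorization p := by
    by_contra! hc
    refine hne (Nat.dvd_antisymm hde ?_)
    rw [← Nat.factorization_prime_le_iff_dvd he0 hd0]
    exact hc
  refine ⟨p, n.primeFactorsList.length, hp, Nat.eq_prime_pow_of_unique_prime_dvd hn ?_⟩
  have hpe : p ^ e.factorization p ∣ e := Nat.ordProj_dvd e p
  have hnd : ¬ p ^ e.factorization p ∣ d := fun hc =>
    absurd ((hp.pow_dvd_iff_le_factorization hd0).1 hc) (by omega)
  have hd_pow : d ∣ p ^ e.factorization p :=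
    ((h _ (hpe.trans hen)).2 (Or.inl hpe)).resolve_left hnd
  obtain ⟨b, -, hb⟩ := (Nat.dvd_prime_pow hp).1 hd_pow
  intro q hq hqn
  by_contra hqp
  have hcop : Nat.Coprime q d := by
    rw [hb]
    exact ((Nat.coprime_primes hq hp).2 hqp).pow_right b
  have hqd : ¬ q ∣ d := fun hc => hq.one_lt.ne' (hcop.eq_one_of_dvd hc)
  have hdq : ¬ d ∣ q := fun hc => hd (hcop.symm.eq_one_of_dvd hc)
  have hqdn : q * d ∣ n := hcop.mul_dvd_of_dvd_of_dvd hqn (hde.trans hen)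
  have hqe : ¬ q ∣ e := fun hc => ((h q hqn).2 (Or.inl hc)).elim hqd hdq
  rcases (h _ hqdn).1 (Or.inr (dvd_mul_left d q)) with hc | hc
  · exact hqe ((dvd_mul_right q d).trans hc)
  · have := (hp.pow_dvd_iff_le_factorization (mul_ne_zero hq.ne_zero hd0)).1 (hpe.trans hc)
    rw [Nat.factorization_mul hq.ne_zero hd0, Finsupp.add_apply, hq.factorization,
      Finsupp.single_eq_of_ne (Ne.symm hqp)] at this
    omega

/-- If distinct comparable cyclic subgroups below `t` have power-graph twins as generators, then `t`
has prime power order. -/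
lemma exists_orderOf_eq_prime_pow_of_twins [Finite G] {v u t : G} (hv : v ≠ 1)
    (hvu : v ∈ zpowers u) (huv : u ∉ zpowers v) (hut : u ∈ zpowers t)
    (h : ∀ s, PowerAdj v s ↔ PowerAdj u s) : ∃ p k, p.Prime ∧ orderOf t = p ^ k := by
  have hvt := mem_zpowers_trans hvu hut
  refine exists_prime_pow_of_comparable (orderOf_pos t).ne' (d := orderOf v) (e := orderOf u)
    (fun hc => hv (orderOf_eq_one_iff.1 hc)) (orderOf_dvd_of_mem_zpowers hvu)
    (fun hc => huv (mem_zpowers_of_orderOf_dvd hut hvt hc.symm.dvd))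
    (orderOf_dvd_of_mem_zpowers hut) fun f hf => ?_
  obtain ⟨s, hs, rfl⟩ := exists_mem_zpowers_orderOf_eq t hf
  have := h s
  rw [powerAdj_iff_orderOf_dvd hvt hs, powerAdj_iff_orderOf_dvd hut hs] at this
  tauto

lemma powerAdj_of_orderOf_eq_prime_pow [Finite G] {x y t : G} (hx : x ∈ zpowers t)
    (hy : y ∈ zpowers t) (ht : ∃ p k, p.Prime ∧ orderOf t = p ^ k) : PowerAdj x y := by
  obtain ⟨p, k, hp, hk⟩ := ht
  obtain ⟨a, -, ha⟩ := (Nat.dvd_prime_pow hp).1 (hk ▸ orderOf_dvd_of_mem_zpowers hx)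
  obtain ⟨b, -, hb⟩ := (Nat.dvd_prime_pow hp).1 (hk ▸ orderOf_dvd_of_mem_zpowers hy)
  rw [powerAdj_iff_orderOf_dvd hx hy, ha, hb]
  exact (le_total a b).imp (pow_dvd_pow p) (pow_dvd_pow p)

lemma powerAdj_congr {w z : G} (h : zpowers w = zpowers z) (t : G) :
    PowerAdj w t ↔ PowerAdj z t := by
  unfold PowerAdj
  rw [h, ← zpowers_le, ← zpowers_le (g := z), h]

lemma totient_le_ncard_powerTwins [Finite G] {z : G} (hz : z ≠ 1) :
    (orderOf z).totient ≤ (powerTwins z).ncard := by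
  rw [← ncard_generators]
  refine Set.ncard_le_ncard (fun w hw => ⟨?_, powerAdj_congr hw⟩) (Set.toFinite _)
  rintro rfl
  exact hz (zpowers_eq_bot.1 (by
    rw [← show zpowers (1 : G) = zpowers z from hw, zpowers_one_eq_bot]))

lemma ncard_powerTwins_le_totient [Finite G] {x y z : G} (hx : x ∈ zpowers z)
    (hy : y ∈ zpowers z) (hxy : ¬ PowerAdj x y) :
    (powerTwins x).ncard ≤ (orderOf x).totient := by
  have hx1 : x ≠ 1 := by
    rintro rfl
    exact hxy (Or.inl (one_mem _))
  rw [← ncard_generators]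
  refine Set.ncard_le_ncard (fun w hw => ?_) (Set.toFinite _)
  have hz : ¬ ∃ p k, p.Prime ∧ orderOf z = p ^ k := fun hc =>
    hxy (powerAdj_of_orderOf_eq_prime_pow hx hy hc)
  by_contra hne
  have hwx : PowerAdj w x := (hw.2 x).2 (Or.inl (mem_zpowers x))
  rcases hwx with hwx | hwx
  · refine hz (exists_orderOf_eq_prime_pow_of_twins hw.1 hwx (fun hc => hne ?_) hx hw.2)
    exact le_antisymm (zpowers_le.2 hwx) (zpowers_le.2 hc)
  · have hxw : w ∉ zpowers x := fun hc =>
      hne (le_antisymm (zpowers_le.2 hc) (zpowers_le.2 hwx))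
    have hzw : PowerAdj w z := (hw.2 z).2 (Or.inl hx)
    rcases hzw with hzw | hzw
    · exact hz (exists_orderOf_eq_prime_pow_of_twins hx1 hwx hxw hzw fun s => (hw.2 s).symm)
    · exact hxy (powerAdj_of_orderOf_eq_prime_pow hwx (mem_zpowers_trans hy hzw)
        (exists_orderOf_eq_prime_pow_of_twins hx1 hwx hxw (mem_zpowers w)
          fun s => (hw.2 s).symm))

lemma ncard_powerTwins_add_lt [Finite G] {x y z : G} (hx : x ∈ zpowers z)
    (hy : y ∈ zpowers z) (hxy : ¬ PowerAdj x y) :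
    (powerTwins x).ncard + (powerTwins y).ncard < 2 * (powerTwins z).ncard := by
  have hx1 : x ≠ 1 := by
    rintro rfl
    exact hxy (Or.inl (one_mem _))
  have hz1 : z ≠ 1 := by
    rintro rfl
    rw [zpowers_one_eq_bot, mem_bot] at hx
    exact hx1 hx
  have h1 := ncard_powerTwins_le_totient hx hy hxy
  have h2 := ncard_powerTwins_le_totient hy hx fun hc => hxy hc.symm
  have h3 := totient_le_ncard_powerTwins hz1
  have hxz := orderOf_dvd_of_mem_zpowers hx
  have hyz := orderOf_dvd_of_mem_zpowers hy
  have h4 := Nat.le_of_dvd (Nat.totient_pos.2 (orderOf_pos z)) (Nat.totient_dvd_of_dvd hxz)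
  have h5 := Nat.le_of_dvd (Nat.totient_pos.2 (orderOf_pos z)) (Nat.totient_dvd_of_dvd hyz)
  rw [powerAdj_iff_orderOf_dvd hx hy] at hxy
  suffices ¬ ((orderOf x).totient = (orderOf z).totient ∧
      (orderOf y).totient = (orderOf z).totient) by omega
  rintro ⟨h6, h7⟩
  rcases Nat.eq_or_eq_of_totient_eq_totient hxz h6 with h6 | h6
  · exact hxy (Or.inr (h6 ▸ hyz))
  rcases Nat.eq_or_eq_of_totient_eq_totient hyz h7 with h7 | h7
  · exact hxy (Or.inl (h7 ▸ hxz))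
  exact hxy (Or.inl (Dvd.intro 1 (by omega)))

lemma ncard_powerTwins_le_of_mem_zpowers [Finite G] {x y z : G} (hz : z ≠ 1)
    (hx : z ∈ zpowers x) (hy : z ∈ zpowers y) (hxy : ¬ PowerAdj x y) :
    (powerTwins z).ncard ≤ (powerTwins x).ncard := by
  have hx1 : x ≠ 1 := by
    rintro rfl
    exact hxy (Or.inl (one_mem _))
  refine le_trans ?_ (totient_le_ncard_powerTwins hx1)
  have hmem : ∀ w ∈ powerTwins z, w ∈ zpowers x := by
    intro w hw
    by_contra hwx
    have hxw : x ∈ zpowers w := ((hw.2 x).2 (Or.inl hx)).resolve_left hwx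
    have hyw : y ∈ zpowers w := by
      refine ((hw.2 y).2 (Or.inl hy)).resolve_left fun hc => hxy (Or.inl ?_)
      exact mem_zpowers_trans hxw hc
    refine hxy (powerAdj_of_orderOf_eq_prime_pow hxw hyw
      (exists_orderOf_eq_prime_pow_of_twins hz (mem_zpowers_trans hx hxw) (fun hc => hwx ?_)
        (mem_zpowers w) fun s => (hw.2 s).symm))
    exact mem_zpowers_trans hc hx
  by_cases hgen : ∀ w ∈ powerTwins z, zpowers w = zpowers z
  · calc (powerTwins z).ncard ≤ {w : G | zpowers w = zpowers z}.ncard :=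
          Set.ncard_le_ncard hgen (Set.toFinite _)
      _ = (orderOf z).totient := ncard_generators z
      _ ≤ (orderOf x).totient :=
          Nat.le_of_dvd (Nat.totient_pos.2 (orderOf_pos x))
            (Nat.totient_dvd_of_dvd (orderOf_dvd_of_mem_zpowers hx))
  push Not at hgen
  obtain ⟨w, hw, hne⟩ := hgen
  obtain ⟨p, k, hp, hk⟩ : ∃ p k, p.Prime ∧ orderOf x = p ^ k := by
    have hwz : PowerAdj w z := (hw.2 z).2 (Or.inl (mem_zpowers z))
    rcases hwz with hwz | hwz
    · exact exists_orderOf_eq_prime_pow_of_twins hw.1 hwz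
        (fun hc => hne (le_antisymm (zpowers_le.2 hwz) (zpowers_le.2 hc))) hx hw.2
    · exact exists_orderOf_eq_prime_pow_of_twins hz hwz
        (fun hc => hne (le_antisymm (zpowers_le.2 hc) (zpowers_le.2 hwz))) (hmem w hw)
        fun s => (hw.2 s).symm
  have hk0 : k ≠ 0 := by
    rintro rfl
    exact hx1 (orderOf_eq_one_iff.1 hk)
  obtain ⟨k, rfl⟩ := Nat.exists_eq_succ_of_ne_zero hk0
  have hsub : powerTwins z ⊆ {g : G | g ∈ zpowers x ∧ g ^ p ^ k = 1} \ {1} := by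
    intro w hw
    refine ⟨⟨hmem w hw, ?_⟩, hw.1⟩
    have hlt : ¬ orderOf x ∣ orderOf w := fun hc => by
      have hxw := mem_zpowers_of_orderOf_dvd (mem_zpowers x) (hmem w hw) hc
      have hwy : PowerAdj w y := (hw.2 y).2 (Or.inl hy)
      have hwx : zpowers w = zpowers x :=
        le_antisymm (zpowers_le.2 (hmem w hw)) (zpowers_le.2 hxw)
      exact hxy ((powerAdj_congr hwx y).1 hwy)
    obtain ⟨a, ha, hwa⟩ := (Nat.dvd_prime_pow hp).1
      (hk ▸ orderOf_dvd_of_mem_zpowers (hmem w hw))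
    rw [← orderOf_dvd_iff_pow_eq_one, hwa]
    refine pow_dvd_pow p (Nat.le_of_lt_succ (lt_of_le_of_ne ha ?_))
    rintro rfl
    exact hlt (by rw [hk, hwa])
  have hcard := Set.ncard_le_ncard hsub (Set.toFinite _)
  rw [Set.ncard_sdiff_singleton_of_mem (by simp),
    ncard_torsion_of_isCyclic _ inferInstance, Nat.card_zpowers, hk,
    Nat.gcd_eq_right (pow_dvd_pow p k.le_succ)] at hcard
  rw [hk, Nat.totient_prime_pow_succ hp]
  have := hp.two_le
  calc _ ≤ p ^ k * 1 := by omega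
    _ ≤ _ := Nat.mul_le_mul_left _ (by omega)

lemma cyclicAdj_iff_exists_powerAdj [Finite G] (x y : G) :
    CyclicAdj x y ↔ PowerAdj x y ∨ ∃ z, z ≠ 1 ∧ PowerAdj x z ∧ PowerAdj y z ∧
      (powerTwins x).ncard + (powerTwins y).ncard < 2 * (powerTwins z).ncard := by
  by_cases hxy : PowerAdj x y
  · simp [hxy, hxy.cyclicAdj]
  simp only [hxy, false_or]
  constructor
  · rintro ⟨z, hx, hy⟩
    refine ⟨z, ?_, Or.inl hx, Or.inl hy, ncard_powerTwins_add_lt hx hy hxy⟩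
    rintro rfl
    rw [zpowers_one_eq_bot, mem_bot] at hx
    subst hx
    exact hxy (Or.inl (one_mem _))
  · rintro ⟨z, hz, hx, hy, hlt⟩
    rcases hx with hx | hx <;> rcases hy with hy | hy
    · exact ⟨z, hx, hy⟩
    · exact absurd (Or.inl (mem_zpowers_trans hx hy)) hxy
    · exact absurd (Or.inr (mem_zpowers_trans hy hx)) hxy
    · have h1 := ncard_powerTwins_le_of_mem_zpowers hz hx hy hxy
      have h2 := ncard_powerTwins_le_of_mem_zpowers hz hy hx fun hc => hxy hc.symm
      omega

end PowerGraph

section EnhancedPowerGraph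

variable {G H : Type*} [Group G] [Group H]

lemma ncard_powerTwins_map (φ : G ≃ H) (h1 : φ 1 = 1)
    (hφ : ∀ x y, PowerAdj x y ↔ PowerAdj (φ x) (φ y)) (x : G) :
    (powerTwins (φ x)).ncard = (powerTwins x).ncard := by
  rw [← Set.ncard_image_of_injective (powerTwins x) φ.injective]
  congr 1
  ext w
  obtain ⟨w, rfl⟩ := φ.surjective w
  rw [φ.injective.mem_set_image]
  simp only [powerTwins, Set.mem_ofPred_eq, φ.surjective.forall, ← hφ]
  rw [← h1, φ.injective.ne_iff]

lemma cyclicAdj_map_of_powerAdj_map [Finite G] [Finite H] (φ : G ≃ H) (h1 : φ 1 = 1)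
    (hφ : ∀ x y, PowerAdj x y ↔ PowerAdj (φ x) (φ y)) (x y : G) :
    CyclicAdj x y ↔ CyclicAdj (φ x) (φ y) := by
  rw [cyclicAdj_iff_exists_powerAdj, cyclicAdj_iff_exists_powerAdj, φ.surjective.exists]
  simp only [ncard_powerTwins_map φ h1 hφ, ← hφ]
  rw [← h1]
  simp only [φ.injective.ne_iff]

/-- The closed neighbourhood of `m` in the enhanced power graph is a clique. -/
def IsCyclicSimplicial (m : G) : Prop :=
  ∀ u v, CyclicAdj m u → CyclicAdj m v → CyclicAdj u v

lemma exists_mem_zpowers_maximal [Finite G] (x : G) :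
    ∃ z, x ∈ zpowers z ∧ ∀ u, CyclicAdj z u → u ∈ zpowers z := by
  obtain ⟨z, hz, hmax⟩ := Set.exists_max_image {z : G | x ∈ zpowers z} orderOf
    (Set.toFinite _) ⟨x, mem_zpowers x⟩
  refine ⟨z, hz, fun u ⟨t, hzt, hut⟩ => ?_⟩
  have hle := hmax t (mem_zpowers_trans hz hzt)
  have heq := le_antisymm (Nat.le_of_dvd (orderOf_pos t) (orderOf_dvd_of_mem_zpowers hzt)) hle
  exact (zpowers_eq_iff_orderOf_eq hzt).2 heq ▸ hut

lemma exists_isCyclicSimplicial [Finite G] (x : G) :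
    ∃ m, IsCyclicSimplicial m ∧ CyclicAdj m x := by
  obtain ⟨z, hz, h⟩ := exists_mem_zpowers_maximal x
  exact ⟨z, fun u v hu hv => ⟨z, h u hu, h v hv⟩, z, mem_zpowers z, hz⟩

lemma IsCyclicSimplicial.exists_subgroup [Finite G] {m : G} (hm : IsCyclicSimplicial m) :
    ∃ K : Subgroup G, IsCyclic K ∧ ∀ x, x ∈ K ↔ CyclicAdj m x := by
  obtain ⟨z, hz, h⟩ := exists_mem_zpowers_maximal m
  refine ⟨zpowers z, inferInstance, fun x => ⟨fun hx => ⟨z, hz, hx⟩, fun hx => h x ?_⟩⟩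
  exact hm z x ⟨z, hz, mem_zpowers z⟩ hx

lemma ncard_torsion_of_isCyclicSimplicial [Finite G] {t : Set G} (ht : t.Nonempty)
    (hs : ∀ m ∈ t, IsCyclicSimplicial m) (n : ℕ) :
    {x : G | ∀ m ∈ t, CyclicAdj m x ∧ x ^ n = 1}.ncard =
      {x : G | ∀ m ∈ t, CyclicAdj m x}.ncard.gcd n := by
  choose! K hK hmem using fun m hm => (hs m hm).exists_subgroup
  obtain ⟨m₀, hm₀⟩ := ht
  have hle : ⨅ m ∈ t, K m ≤ K m₀ := iInf₂_le m₀ hm₀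
  have hcyc : IsCyclic (⨅ m ∈ t, K m : Subgroup G) :=
    have := hK m₀ hm₀
    isCyclic_of_injective (Subgroup.inclusion hle) (Subgroup.inclusion_injective hle)
  have hall : ∀ x, x ∈ ⨅ m ∈ t, K m ↔ ∀ m ∈ t, CyclicAdj m x := by
    intro x
    simp only [mem_iInf]
    exact forall₂_congr fun m hm => hmem m hm x
  have h1 : {x : G | ∀ m ∈ t, CyclicAdj m x} = ((⨅ m ∈ t, K m : Subgroup G) : Set G) :=
    Set.ext fun x => (hall x).symm
  rw [h1, show ((⨅ m ∈ t, K m : Subgroup G) : Set G).ncard = Nat.card (⨅ m ∈ t, K m : Subgroup G)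
    from (Nat.card_coe_set_eq _).symm, ← ncard_torsion_of_isCyclic _ hcyc]
  congr 1
  ext x
  simp only [Set.mem_ofPred_eq, hall]
  exact ⟨fun h => ⟨fun m hm => (h m hm).1, (h m₀ hm₀).2⟩, fun h m hm => ⟨h.1 m hm, h.2⟩⟩

lemma ncard_torsion_eq_of_cyclicAdj_map [Finite G] [Finite H] (φ : G ≃ H)
    (hφ : ∀ x y, CyclicAdj x y ↔ CyclicAdj (φ x) (φ y)) (n : ℕ) :
    {x : G | x ^ n = 1}.ncard = {x : H | x ^ n = 1}.ncard := by
  classical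
  have := Fintype.ofFinite G
  have := Fintype.ofFinite H
  have hsimp : ∀ m : G, IsCyclicSimplicial m ↔ IsCyclicSimplicial (φ m) := fun m => by
    simp only [IsCyclicSimplicial, φ.surjective.forall, ← hφ]
  let s : Finset G := {m | IsCyclicSimplicial m}
  let A : G → Finset G := fun m => {x | CyclicAdj m x ∧ x ^ n = 1}
  let B : G → Finset H := fun m => {x | CyclicAdj (φ m) x ∧ x ^ n = 1}
  have hA : (s.biUnion A : Set G) = {x : G | x ^ n = 1} := by
    ext x
    simp only [s, A, Finset.coe_biUnion, Finset.coe_filter, Finset.mem_univ, true_and,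
      Set.mem_ofPred_eq, Set.mem_iUnion, exists_prop]
    refine ⟨fun ⟨m, _, h⟩ => h.2, fun h => ?_⟩
    obtain ⟨m, hm, hx⟩ := exists_isCyclicSimplicial x
    exact ⟨m, hm, hx, h⟩
  have hB : (s.biUnion B : Set H) = {x : H | x ^ n = 1} := by
    ext x
    simp only [s, B, Finset.coe_biUnion, Finset.coe_filter, Finset.mem_univ, true_and,
      Set.mem_ofPred_eq, Set.mem_iUnion, exists_prop]
    refine ⟨fun ⟨m, _, h⟩ => h.2, fun h => ?_⟩
    obtain ⟨m, hm, hx⟩ := exists_isCyclicSimplicial x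
    obtain ⟨m, rfl⟩ := φ.surjective m
    exact ⟨m, (hsimp m).2 hm, hx, h⟩
  rw [← hA, ← hB, Set.ncard_coe_finset, Set.ncard_coe_finset, ← Nat.cast_inj (R := ℤ),
    Finset.inclusion_exclusion_card_biUnion, Finset.inclusion_exclusion_card_biUnion]
  refine Finset.sum_congr rfl fun t _ => ?_
  obtain ⟨t, ht⟩ := t
  obtain ⟨hts, hne⟩ := Finset.mem_filter.1 ht
  have hts : ∀ m ∈ t, IsCyclicSimplicial m := fun m hm =>
    (Finset.mem_filter.1 (Finset.mem_powerset.1 hts hm)).2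
  congr 2
  have hA' : ((t.inf' hne A : Finset G) : Set G) =
      {x : G | ∀ m ∈ (t : Set G), CyclicAdj m x ∧ x ^ n = 1} := by
    ext x
    simp [A, Finset.mem_inf']
  have hB' : ((t.inf' hne B : Finset H) : Set H) =
      {x : H | ∀ m ∈ φ '' (t : Set G), CyclicAdj m x ∧ x ^ n = 1} := by
    ext x
    simp only [B, Finset.mem_coe, Finset.mem_inf', Finset.mem_filter, Finset.mem_univ, true_and,
      Set.mem_ofPred_eq, Set.forall_mem_image]
  rw [← Set.ncard_coe_finset, ← Set.ncard_coe_finset, hA', hB',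
    ncard_torsion_of_isCyclicSimplicial hne hts,
    ncard_torsion_of_isCyclicSimplicial ((Finset.coe_nonempty.2 hne).image φ)
      (Set.forall_mem_image.2 fun m hm => (hsimp m).1 (hts m hm))]
  congr 1
  rw [← Set.ncard_image_of_injective _ φ.injective]
  congr 1
  ext x
  obtain ⟨x, rfl⟩ := φ.surjective x
  rw [φ.injective.mem_set_image]
  simp only [Set.mem_ofPred_eq, Set.forall_mem_image, ← hφ]

lemma ncard_torsion_of_isNilpotent [Finite G] [Group.IsNilpotent G] (p : ℕ) [Fact p.Prime] :
    {x : G | x ^ p ^ (Nat.card G).factorization p = 1}.ncard =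
      p ^ (Nat.card G).factorization p := by
  obtain ⟨P⟩ : Nonempty (Sylow p G) := inferInstance
  have hcard := P.card_eq_multiplicity
  have := Sylow.unique_of_normal P inferInstance
  have hset : {x : G | x ^ p ^ (Nat.card G).factorization p = 1} = ((P : Subgroup G) : Set G) := by
    ext x
    refine ⟨fun hx => ?_, fun hx => ?_⟩
    · have hx' : IsPGroup p (zpowers x) := IsPGroup.of_card_dvd_pow (by
        rw [Nat.card_zpowers]
        exact orderOf_dvd_iff_pow_eq_one.2 hx)
      obtain ⟨Q, hQ⟩ := hx'.exists_le_sylow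
      rw [Subsingleton.elim P Q]
      exact hQ (mem_zpowers x)
    · have := pow_card_eq_one' (x := (⟨x, hx⟩ : (P : Subgroup G)))
      rw [hcard] at this
      exact congrArg Subtype.val this
  rw [hset, ← Nat.card_coe_set_eq]
  exact hcard

lemma isNilpotent_of_subsingleton_sylow [Finite G]
    (h : ∀ (p : ℕ) [Fact p.Prime], Subsingleton (Sylow p G)) : Group.IsNilpotent G :=
  (Group.isNilpotent_of_finite_tfae (G := G)).out 3 0 |>.1 fun p hp P =>
    have := @h p hp
    Sylow.normal_of_subsingleton P

lemma isNilpotent_of_ncard_torsion [Finite G]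
    (h : ∀ (p : ℕ) [Fact p.Prime], {x : G | x ^ p ^ (Nat.card G).factorization p = 1}.ncard =
      p ^ (Nat.card G).factorization p) : Group.IsNilpotent G := by
  refine isNilpotent_of_subsingleton_sylow fun p _ => ⟨fun P Q => Sylow.ext ?_⟩
  have key : ∀ P : Sylow p G, ((P : Subgroup G) : Set G) =
      {x : G | x ^ p ^ (Nat.card G).factorization p = 1} := by
    intro P
    have hcard := P.card_eq_multiplicity
    refine Set.eq_of_subset_of_ncard_le (fun x hx => ?_) ?_ (Set.toFinite _)
    · have := pow_card_eq_one' (x := (⟨x, hx⟩ : (P : Subgroup G)))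
      rw [hcard] at this
      exact congrArg Subtype.val this
    · rw [h p, ← Nat.card_coe_set_eq]
      exact hcard.ge
  exact SetLike.coe_injective ((key P).trans (key Q).symm)

lemma isNilpotent_of_cyclicAdj_map [Finite G] [Finite H] [Group.IsNilpotent H] (φ : G ≃ H)
    (hφ : ∀ x y, CyclicAdj x y ↔ CyclicAdj (φ x) (φ y)) : Group.IsNilpotent G := by
  refine isNilpotent_of_ncard_torsion fun p _ => ?_
  rw [ncard_torsion_eq_of_cyclicAdj_map φ hφ, Nat.card_congr φ, ncard_torsion_of_isNilpotent]

end EnhancedPowerGraph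

section Independence

variable {G H : Type*} [Group G] [Group H]

lemma independent_singleton_iff (x : G) : Independent ({x} : Set G) ↔ x ≠ 1 := by
  simp [Independent]

lemma independent_pair_iff {x y : G} (hxy : x ≠ y) :
    Independent ({x, y} : Set G) ↔ ¬ PowerAdj x y := by
  have h1 : ({x, y} : Set G) \ {x} = {y} := by
    ext z; simp; grind
  have h2 : ({x, y} : Set G) \ {y} = {x} := by
    ext z; simp; grind
  simp only [Independent, Set.mem_insert_iff, Set.mem_singleton_iff, forall_eq_or_imp, forall_eq,
    h1, h2, ← zpowers_eq_closure, PowerAdj, not_or]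

lemma dgen_zpowers_le_one (z : G) : dgen (zpowers z) ≤ 1 :=
  Nat.sInf_le ⟨{z}, Set.finite_singleton z, by simp, (zpowers_eq_closure z).symm,
    Set.ncard_singleton z⟩

lemma exists_zpowers_eq_of_dgen_le_one [Finite G] {K : Subgroup G} (h : dgen K ≤ 1) :
    ∃ z, zpowers z = K := by
  obtain ⟨S, hfin, -, hS, hcard⟩ := Nat.sInf_mem
    (s := {n : ℕ | ∃ S : Set G, S.Finite ∧ S ⊆ (K : Set G) ∧ closure S = K ∧ S.ncard = n})
    ⟨_, K, Set.toFinite _, le_rfl, closure_eq K, rfl⟩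
  have hle : S.ncard ≤ 1 := hcard.le.trans h
  rcases ((Set.ncard_le_one_iff_subsingleton).1 hle).eq_empty_or_singleton with rfl | ⟨z, rfl⟩
  · exact ⟨1, by rw [← hS, Subgroup.closure_empty, zpowers_one_eq_bot]⟩
  · exact ⟨z, by rw [← hS, zpowers_eq_closure]⟩

lemma stronglyIndependent_pair_iff [Finite G] {x y : G} (hxy : x ≠ y) :
    StronglyIndependent ({x, y} : Set G) ↔ ¬ CyclicAdj x y := by
  simp only [StronglyIndependent, Set.ncard_pair hxy, Set.insert_subset_iff,
    Set.singleton_subset_iff, SetLike.mem_coe]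
  constructor
  · rintro h ⟨z, hx, hy⟩
    exact absurd ((h _ ⟨hx, hy⟩).trans (dgen_zpowers_le_one z)) (by norm_num)
  · rintro h K ⟨hx, hy⟩
    by_contra! hlt
    obtain ⟨z, rfl⟩ := exists_zpowers_eq_of_dgen_le_one (Nat.le_of_lt_succ hlt)
    exact h ⟨z, hx, hy⟩

lemma isNilpotent_of_independent_map [Finite G] [Finite H] [Group.IsNilpotent H] (φ : G ≃ H)
    (hφ : ∀ X : Set G, Independent X ↔ Independent (φ '' X)) : Group.IsNilpotent G := by
  have h1 : φ 1 = 1 := by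
    have := hφ {1}
    rw [Set.image_singleton, independent_singleton_iff, independent_singleton_iff] at this
    tauto
  refine isNilpotent_of_cyclicAdj_map φ (cyclicAdj_map_of_powerAdj_map φ h1 fun x y => ?_)
  rcases eq_or_ne x y with rfl | hxy
  · simp [PowerAdj]
  have := hφ {x, y}
  rwa [Set.image_pair, independent_pair_iff hxy, independent_pair_iff (φ.injective.ne hxy),
    not_iff_not] at this

lemma isNilpotent_of_stronglyIndependent_map [Finite G] [Finite H] [Group.IsNilpotent H]
    (φ : G ≃ H) (hφ : ∀ X : Set G, StronglyIndependent X ↔ StronglyIndependent (φ '' X)) :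
    Group.IsNilpotent G := by
  refine isNilpotent_of_cyclicAdj_map φ fun x y => ?_
  rcases eq_or_ne x y with rfl | hxy
  · exact iff_of_true ⟨x, mem_zpowers x, mem_zpowers x⟩ ⟨_, mem_zpowers _, mem_zpowers _⟩
  have := hφ {x, y}
  rwa [Set.image_pair, stronglyIndependent_pair_iff hxy,
    stronglyIndependent_pair_iff (φ.injective.ne hxy), not_iff_not] at this

end Independence

section SubgroupLattice

variable {G H : Type*} [Group G] [Group H]

lemma exists_subgroup_card_eq_of_dvd [Finite G] (K : Subgroup G) {p : ℕ} (hp : p.Prime)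
    (h : p ∣ Nat.card K) : ∃ A ≤ K, Nat.card A = p := by
  have := Fact.mk hp
  obtain ⟨x, hx⟩ := exists_prime_orderOf_dvd_card' p h
  refine ⟨zpowers (x : G), zpowers_le.2 x.2, ?_⟩
  rw [Nat.card_zpowers, orderOf_coe, hx]

lemma isPGroup_of_forall_prime_card [Finite G] {K : Subgroup G} {p : ℕ}
    (h : ∀ A ≤ K, (Nat.card A).Prime → Nat.card A = p) : IsPGroup p K := by
  refine IsPGroup.of_card (Nat.eq_prime_pow_of_unique_prime_dvd Nat.card_pos.ne' ?_)
  intro q hq hqd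
  obtain ⟨A, hA, rfl⟩ := exists_subgroup_card_eq_of_dvd K hq hqd
  exact h A hA hq

lemma isAtom_iff_card_prime [Finite G] (A : Subgroup G) : IsAtom A ↔ (Nat.card A).Prime := by
  constructor
  · rintro ⟨hne, h⟩
    obtain ⟨p, hp, hpd⟩ := Nat.exists_prime_and_dvd fun hc => hne (card_eq_one.1 hc)
    obtain ⟨B, hB, rfl⟩ := exists_subgroup_card_eq_of_dvd A hp hpd
    rcases hB.lt_or_eq with hlt | rfl
    · rw [h B hlt, card_bot] at hp
      exact absurd hp Nat.not_prime_one
    · exact hp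
  · intro hp
    refine ⟨?_, fun B hB => ?_⟩
    · rintro rfl
      rw [card_bot] at hp
      exact Nat.not_prime_one hp
    · rcases (Nat.dvd_prime hp).1 (card_dvd_of_le hB.le) with hc | hc
      · exact card_eq_one.1 hc
      · exact absurd (eq_of_le_of_card_ge hB.le hc.ge) hB.ne

lemma exists_zpowers_eq_of_card_prime [Finite G] {A : Subgroup G} (hA : (Nat.card A).Prime) :
    ∃ a, orderOf a = Nat.card A ∧ zpowers a = A := by
  have := Fact.mk hA
  obtain ⟨x, hx⟩ := exists_prime_orderOf_dvd_card' (G := A) _ dvd_rfl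
  refine ⟨x, by rw [orderOf_coe, hx], eq_of_le_of_card_ge (zpowers_le.2 x.2) ?_⟩
  rw [Nat.card_zpowers, orderOf_coe, hx]

lemma commute_of_isNilpotent [Finite G] [Group.IsNilpotent G] {a b : G} {p q : ℕ} (hp : p.Prime)
    (hq : q.Prime) (hpq : p ≠ q) (ha : orderOf a = p) (hb : orderOf b = q) : Commute a b := by
  have := Fact.mk hp
  have := Fact.mk hq
  obtain ⟨P, hP⟩ := (IsPGroup.of_card (p := p) (n := 1)
    (by rw [Nat.card_zpowers, ha, pow_one] : Nat.card (zpowers a) = p ^ 1)).exists_le_sylow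
  obtain ⟨Q, hQ⟩ := (IsPGroup.of_card (p := q) (n := 1)
    (by rw [Nat.card_zpowers, hb, pow_one] : Nat.card (zpowers b) = q ^ 1)).exists_le_sylow
  exact commute_of_normal_of_disjoint P.1 Q.1 inferInstance inferInstance
    (IsPGroup.disjoint_of_ne p q hpq _ _ P.2 Q.2) a b (hP (mem_zpowers a)) (hQ (mem_zpowers b))

lemma le_or_le_or_eq_sup_of_isNilpotent [Finite G] [Group.IsNilpotent G] {A B D : Subgroup G}
    (hA : (Nat.card A).Prime) (hB : (Nat.card B).Prime) (hAB : Nat.card A ≠ Nat.card B)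
    (hD : D ≤ A ⊔ B) : D ≤ A ∨ D ≤ B ∨ D = A ⊔ B := by
  obtain ⟨a, ha, hAa⟩ := exists_zpowers_eq_of_card_prime hA
  obtain ⟨b, hb, hBb⟩ := exists_zpowers_eq_of_card_prime hB
  have hcop : (orderOf a).Coprime (orderOf b) := by
    rw [ha, hb]
    exact (Nat.coprime_primes hA hB).2 hAB
  have hcomm : Commute a b := commute_of_isNilpotent hA hB hAB ha hb
  have hord := hcomm.orderOf_mul_eq_mul_orderOf_of_coprime hcop
  have haz : a ∈ zpowers (a * b) := by
    refine mem_zpowers_trans (mem_zpowers_pow_iff.2 hcop.symm) (y := a ^ orderOf b) ?_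
    have : (a * b) ^ orderOf b = a ^ orderOf b := by
      rw [hcomm.mul_pow, pow_orderOf_eq_one, mul_one]
    exact this ▸ pow_mem (mem_zpowers _) _
  have hbz : b ∈ zpowers (a * b) := by
    refine mem_zpowers_trans (mem_zpowers_pow_iff.2 hcop) (y := b ^ orderOf a) ?_
    have : (a * b) ^ orderOf a = b ^ orderOf a := by
      rw [hcomm.mul_pow, pow_orderOf_eq_one, one_mul]
    exact this ▸ pow_mem (mem_zpowers _) _
  have hsup : A ⊔ B ≤ zpowers (a * b) := by
    rw [← hAa, ← hBb]
    exact sup_le (zpowers_le.2 haz) (zpowers_le.2 hbz)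
  rw [← or_assoc, or_iff_not_imp_left, not_or, SetLike.not_le_iff_exists,
    SetLike.not_le_iff_exists]
  rintro ⟨⟨g, hgD, hgA⟩, h, hhD, hhB⟩
  have key : ∀ {c d x : G}, c ∈ zpowers (a * b) → x ∈ zpowers (a * b) → (orderOf d).Prime →
      orderOf (a * b) = orderOf c * orderOf d → x ∉ zpowers c → orderOf d ∣ orderOf x := by
    intro c d x hc hx hd ho hxc
    by_contra hcon
    refine hxc (mem_zpowers_of_orderOf_dvd hx hc ?_)
    exact (((Nat.Prime.coprime_iff_not_dvd hd).2 hcon).symm).dvd_of_dvd_mul_right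
      (ho ▸ orderOf_dvd_of_mem_zpowers hx)
  have h1 : orderOf b ∣ Nat.card D :=
    (key haz (hsup (hD hgD)) (hb ▸ hB) hord (hAa ▸ hgA)).trans (D.orderOf_dvd_natCard hgD)
  have h2 : orderOf a ∣ Nat.card D :=
    (key hbz (hsup (hD hhD)) (ha ▸ hA) (hord.trans (mul_comm _ _)) (hBb ▸ hhB)).trans
      (D.orderOf_dvd_natCard hhD)
  have h3 := hcop.mul_dvd_of_dvd_of_dvd h2 h1
  rw [← hord, ← Nat.card_zpowers] at h3
  exact le_antisymm hD
    (hsup.trans (eq_of_le_of_card_ge (hD.trans hsup) (Nat.le_of_dvd Nat.card_pos h3)).ge)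

lemma exists_le_sup_not_le_of_card_eq [Finite G] {A B : Subgroup G} (hA : (Nat.card A).Prime)
    (hcard : Nat.card A = Nat.card B) (hAB : A ≠ B) :
    ∃ D ≤ A ⊔ B, ¬ D ≤ A ∧ ¬ D ≤ B ∧ D ≠ A ⊔ B := by
  obtain ⟨a, ha, hAa⟩ := exists_zpowers_eq_of_card_prime hA
  obtain ⟨b, hb, hBb⟩ := exists_zpowers_eq_of_card_prime (hcard ▸ hA)
  have haA : a ∈ A := hAa ▸ mem_zpowers a
  have hbB : b ∈ B := hBb ▸ mem_zpowers b
  have haB : a ∉ B := fun hc =>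
    hAB (eq_of_le_of_card_ge (hAa ▸ zpowers_le.2 hc) hcard.ge)
  have hbA : b ∉ A := fun hc =>
    hAB (eq_of_le_of_card_ge (hBb ▸ zpowers_le.2 hc) hcard.le).symm
  refine ⟨zpowers (a * b), zpowers_le.2 (mul_mem_sup haA hbB), fun hc => hbA ?_,
    fun hc => haB ?_, fun hc => haB ?_⟩
  · exact (mul_mem_cancel_left haA).1 (zpowers_le.1 hc)
  · exact (mul_mem_cancel_right hbB).1 (zpowers_le.1 hc)
  · rw [← hBb]
    exact mem_zpowers_of_orderOf_dvd (hc ▸ mem_sup_left haA) (hc ▸ mem_sup_right hbB)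
      (by rw [ha, hb, hcard])

lemma card_prime_map [Finite G] [Finite H] (e : Subgroup G ≃o Subgroup H) (A : Subgroup G) :
    (Nat.card (e A)).Prime ↔ (Nat.card A).Prime := by
  rw [← isAtom_iff_card_prime, ← isAtom_iff_card_prime, e.isAtom_iff]

lemma card_map_eq_of_card_eq [Finite G] [Finite H] [Group.IsNilpotent H]
    (e : Subgroup G ≃o Subgroup H) {A B : Subgroup G} (hA : (Nat.card A).Prime)
    (hcard : Nat.card A = Nat.card B) : Nat.card (e A) = Nat.card (e B) := by
  by_contra hne
  have hAB : A ≠ B := by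
    rintro rfl
    exact hne rfl
  obtain ⟨D, hD, h1, h2, h3⟩ := exists_le_sup_not_le_of_card_eq hA hcard hAB
  have := le_or_le_or_eq_sup_of_isNilpotent ((card_prime_map e A).2 hA)
    ((card_prime_map e B).2 (hcard ▸ hA)) hne (D := e D)
    (by rw [← e.map_sup]; exact e.monotone hD)
  rw [← e.map_sup, e.le_iff_le, e.le_iff_le, e.injective.eq_iff] at this
  tauto

lemma card_eq_of_card_map_eq [Finite G] [Finite H] [Group.IsNilpotent H]
    (e : Subgroup G ≃o Subgroup H) (hGH : Nat.card G = Nat.card H) {A B : Subgroup G}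
    (hA : (Nat.card A).Prime) (hcard : Nat.card (e A) = Nat.card (e B)) :
    Nat.card A = Nat.card B := by
  have hB : (Nat.card B).Prime := by
    rwa [← card_prime_map e, ← hcard, card_prime_map e]
  have hex : ∀ p ∈ (Nat.card G).primeFactors, ∃ K : Subgroup G, Nat.card K = p := by
    intro p hp
    obtain ⟨K, -, hK⟩ := exists_subgroup_card_eq_of_dvd (⊤ : Subgroup G)
      (Nat.prime_of_mem_primeFactors hp) (by
        rw [card_top]
        exact Nat.dvd_of_mem_primeFactors hp)
    exact ⟨K, hK⟩
  choose! K hK using hex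
  have hmem : ∀ {A : Subgroup G}, (Nat.card A).Prime →
      Nat.card A ∈ (Nat.card G).primeFactors := fun hA =>
    Nat.mem_primeFactors.2 ⟨hA, card_subgroup_dvd_card _, Nat.card_pos.ne'⟩
  have hf : ∀ {A : Subgroup G}, (Nat.card A).Prime →
      Nat.card (e (K (Nat.card A))) = Nat.card (e A) := fun {A} hA =>
    (card_map_eq_of_card_eq e hA (hK _ (hmem hA)).symm).symm
  have hinj : Set.InjOn (fun p => Nat.card (e (K p))) (Nat.card G).primeFactors := by
    refine Finset.injOn_of_surjOn_of_card_le (t := (Nat.card G).primeFactors) _ ?_ ?_ le_rfl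
    · intro p hp
      have hp' : (Nat.card (e (K p))).Prime := by
        rw [card_prime_map, hK p hp]
        exact Nat.prime_of_mem_primeFactors hp
      exact Nat.mem_primeFactors.2
        ⟨hp', hGH ▸ card_subgroup_dvd_card _, Nat.card_pos.ne'⟩
    · intro q hq
      obtain ⟨B, -, hB⟩ := exists_subgroup_card_eq_of_dvd (⊤ : Subgroup H)
        (Nat.prime_of_mem_primeFactors hq) (by
          rw [card_top, ← hGH]
          exact Nat.dvd_of_mem_primeFactors hq)
      obtain ⟨A, rfl⟩ := e.surjective B
      have hA : (Nat.card A).Prime := by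
        rw [← card_prime_map e, hB]
        exact Nat.prime_of_mem_primeFactors hq
      exact ⟨Nat.card A, hmem hA, (hf hA).trans hB⟩
  refine hinj (hmem hA) (hmem hB) ?_
  simp only [hf hA, hf hB, hcard]

lemma isNilpotent_of_subgroup_orderIso [Finite G] [Finite H] [Group.IsNilpotent H]
    (hGH : Nat.card G = Nat.card H) (e : Subgroup G ≃o Subgroup H) : Group.IsNilpotent G := by
  refine isNilpotent_of_subsingleton_sylow fun p hp => ⟨fun S S' => Sylow.ext ?_⟩
  by_cases hpG : p ∣ Nat.card G
  · obtain ⟨A₀, -, hA₀⟩ := exists_subgroup_card_eq_of_dvd (⊤ : Subgroup G) hp.out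
      (by rwa [card_top])
    have hq : (Nat.card (e A₀)).Prime := by rw [card_prime_map, hA₀]; exact hp.out
    have := Fact.mk hq
    obtain ⟨Q⟩ : Nonempty (Sylow (Nat.card (e A₀)) H) := inferInstance
    have := Sylow.unique_of_normal Q inferInstance
    have hQ : IsPGroup p (e.symm Q) := by
      refine isPGroup_of_forall_prime_card fun A hA hAp => ?_
      rw [← hA₀]
      refine card_eq_of_card_map_eq e hGH hAp ?_
      have hle : e A ≤ Q := e.le_symm_apply.1 hA
      obtain ⟨n, hn⟩ := isPGroup_iff_card_dvd_pow.1 (Q.2.to_le hle)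
      exact (Nat.prime_dvd_prime_iff_eq ((card_prime_map e A).2 hAp) hq).1
        (((card_prime_map e A).2 hAp).dvd_of_dvd_pow hn)
    have key : ∀ S : Sylow p G, e.symm Q = S := by
      intro S
      refine S.is_maximal' hQ (e.le_symm_apply.2 ?_)
      have hS : IsPGroup (Nat.card (e A₀)) (e S) := by
        refine isPGroup_of_forall_prime_card fun B hB hBp => ?_
        obtain ⟨A, rfl⟩ := e.surjective B
        rw [card_prime_map] at hBp
        refine card_map_eq_of_card_eq e hBp ?_
        obtain ⟨n, hn⟩ := isPGroup_iff_card_dvd_pow.1 (S.2.to_le (e.le_iff_le.1 hB))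
        rw [hA₀]
        exact (Nat.prime_dvd_prime_iff_eq hBp hp.out).1 (hBp.dvd_of_dvd_pow hn)
      obtain ⟨Q', hQ'⟩ := hS.exists_le_sylow
      rwa [Subsingleton.elim Q Q']
    exact (key S).symm.trans (key S')
  · have key : ∀ S : Sylow p G, (S : Subgroup G) = ⊥ := by
      intro S
      have := S.card_eq_multiplicity
      rw [Nat.factorization_eq_zero_of_not_dvd hpG, pow_zero] at this
      exact card_eq_one.1 this
    exact (key S).trans (key S').symm

end SubgroupLattice

theorem nilpotency_invariance (G H : Type) [Group G] [Finite G] [Group H] [Finite H]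
    (hH : Group.IsNilpotent H) :
    ((∃ φ : G ≃ H, ∀ X : Set G, Independent X ↔ Independent (φ '' X)) →
        Group.IsNilpotent G) ∧
    ((∃ φ : G ≃ H, ∀ X : Set G, StronglyIndependent X ↔ StronglyIndependent (φ '' X)) →
        Group.IsNilpotent G) ∧
    ((Nat.card G = Nat.card H ∧ Nonempty (Subgroup G ≃o Subgroup H)) →
        Group.IsNilpotent G) := by
  exact ⟨fun ⟨φ, hφ⟩ => isNilpotent_of_independent_map φ hφ,
    fun ⟨φ, hφ⟩ => isNilpotent_of_stronglyIndependent_map φ hφ,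
    fun ⟨hcard, ⟨e⟩⟩ => isNilpotent_of_subgroup_orderIso hcard e⟩
end

section
/- Let G1 and G2 be finite groups and suppose there exists an index-preserving lattice isomorphism α from the subgroup lattice of G1 to the subgroup lattice of G2. Then there exists a bijection γ : G1 → G2 such that ⟨γ(g)⟩ = α(⟨g⟩) for every g ∈ G1, and for every subset X of G1: X is independent in G1 if and only if γ(X) is independent in G2, and X is strongly independent in G1 if and only if γ(X) is strongly independent in G2. -/
open Classical in
/-- The order of a finite subgroup is the sum over its subgroups of their numbers of
single generators. -/
theorem Subgroup.natCard_eq_sum_natCard_zpowers_eq {G : Type*} [Group G] [Finite G]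
    [Fintype (Subgroup G)] (H : Subgroup G) :
    Nat.card H = Nat.card {g : G // zpowers g = H} +
      ∑ K with K < H, Nat.card {g : G // zpowers g = K} := by
  have := Fintype.ofFinite G
  have hmaps : ∀ g ∈ ({g | g ∈ H} : Finset G),
      zpowers g ∈ ({K | K ≤ H} : Finset (Subgroup G)) := by
    intro g hg
    simpa using hg
  have hsplit : ({K | K ≤ H} : Finset (Subgroup G)) =
      insert H ({K | K < H} : Finset (Subgroup G)) := by
    ext K
    simp [le_iff_eq_or_lt]
  have hcard : Nat.card H = ∑ K with K ≤ H, Nat.card {g : G // zpowers g = K} := by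
    calc Nat.card H = ({g | g ∈ H} : Finset G).card := by
          rw [Nat.card_eq_fintype_card, Fintype.card_subtype]
      _ = _ := Finset.card_eq_sum_card_fiberwise hmaps
      _ = _ := by
          refine Finset.sum_congr rfl fun K hK => ?_
          rw [Nat.card_eq_fintype_card, Fintype.card_subtype, Finset.filter_filter]
          congr 1
          ext g
          simp only [Finset.mem_filter, Finset.mem_univ, true_and] at hK ⊢
          refine ⟨fun h => h.2, fun h => ⟨?_, h⟩⟩
          rw [← zpowers_le, h]
          exact hK
  rw [hcard, hsplit, Finset.sum_insert (by simp)]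

/-- An index-preserving lattice isomorphism preserves the number of single generators. -/
theorem Subgroup.natCard_zpowers_eq_orderIso {G₁ G₂ : Type*} [Group G₁] [Finite G₁] [Group G₂]
    [Finite G₂] (α : Subgroup G₁ ≃o Subgroup G₂)
    (hα : ∀ H : Subgroup G₁, Nat.card (α H) = Nat.card H) (H : Subgroup G₁) :
    Nat.card {g : G₁ // zpowers g = H} = Nat.card {g : G₂ // zpowers g = α H} := by
  classical
  have := Fintype.ofFinite (Subgroup G₁)
  have := Fintype.ofFinite (Subgroup G₂)
  induction H using WellFoundedLT.induction with
  | _ H ih =>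
    have h₁ := natCard_eq_sum_natCard_zpowers_eq H
    have h₂ := natCard_eq_sum_natCard_zpowers_eq (α H)
    have hsum : ∑ K with K < H, Nat.card {g : G₁ // zpowers g = K} =
        ∑ K with K < α H, Nat.card {g : G₂ // zpowers g = K} :=
      Finset.sum_equiv α.toEquiv (by simp) fun K hK => ih K (by simpa using hK)
    have := hα H
    omega

/-- An index-preserving lattice isomorphism is induced on cyclic subgroups by a bijection. -/
theorem Subgroup.exists_equiv_zpowers_eq_orderIso {G₁ G₂ : Type*} [Group G₁] [Finite G₁]
    [Group G₂] [Finite G₂] (α : Subgroup G₁ ≃o Subgroup G₂)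
    (hα : ∀ H : Subgroup G₁, Nat.card (α H) = Nat.card H) :
    ∃ γ : G₁ ≃ G₂, ∀ g, zpowers (γ g) = α (zpowers g) := by
  have e (H : Subgroup G₁) : {g : G₁ // zpowers g = H} ≃ {g : G₂ // zpowers g = α H} :=
    (Finite.card_eq.1 (natCard_zpowers_eq_orderIso α hα H)).some
  refine ⟨(Equiv.sigmaFiberEquiv (zpowers (G := G₁))).symm.trans
    ((Equiv.sigmaCongr α.toEquiv e).trans (Equiv.sigmaFiberEquiv (zpowers (G := G₂)))),
    fun g => ?_⟩
  exact (e (zpowers g) ⟨g, rfl⟩).2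

section InducedBijection

variable {G₁ G₂ : Type*} [Group G₁] [Group G₂] {α : Subgroup G₁ ≃o Subgroup G₂} {γ : G₁ ≃ G₂}

theorem Subgroup.apply_mem_orderIso_iff
    (hγ : ∀ g, zpowers (γ g) = α (zpowers g)) {g : G₁} {H : Subgroup G₁} :
    γ g ∈ α H ↔ g ∈ H := by
  rw [← zpowers_le, hγ, α.le_iff_le, zpowers_le]

theorem Subgroup.image_subset_orderIso_iff
    (hγ : ∀ g, zpowers (γ g) = α (zpowers g)) {X : Set G₁} {H : Subgroup G₁} :
    γ '' X ⊆ α H ↔ X ⊆ H := by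
  rw [Set.image_subset_iff]
  exact forall₂_congr fun _ _ => apply_mem_orderIso_iff hγ

theorem Subgroup.closure_image_eq_orderIso
    (hγ : ∀ g, zpowers (γ g) = α (zpowers g)) (X : Set G₁) :
    closure (γ '' X) = α (closure X) := by
  refine eq_of_forall_ge_iff fun K => ?_
  obtain ⟨H, rfl⟩ := α.surjective K
  rw [closure_le, image_subset_orderIso_iff hγ, α.le_iff_le, closure_le]

theorem dgen_orderIso (hγ : ∀ g, Subgroup.zpowers (γ g) = α (Subgroup.zpowers g))
    (H : Subgroup G₁) : dgen (α H) = dgen H := by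
  unfold dgen
  congr 1
  ext n
  constructor
  · rintro ⟨S, hfin, hS, hcl, rfl⟩
    obtain ⟨T, rfl⟩ := γ.surjective.image_surjective S
    rw [Subgroup.closure_image_eq_orderIso hγ] at hcl
    exact ⟨T, (Set.finite_image_iff γ.injective.injOn).1 hfin,
      (Subgroup.image_subset_orderIso_iff hγ).1 hS, α.injective hcl,
      (Set.ncard_image_of_injective T γ.injective).symm⟩
  · rintro ⟨T, hfin, hT, rfl, rfl⟩
    exact ⟨γ '' T, hfin.image γ, (Subgroup.image_subset_orderIso_iff hγ).2 hT,
      Subgroup.closure_image_eq_orderIso hγ T, Set.ncard_image_of_injective T γ.injective⟩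

theorem independent_image_iff (hγ : ∀ g, Subgroup.zpowers (γ g) = α (Subgroup.zpowers g))
    (X : Set G₁) : Independent (γ '' X) ↔ Independent X := by
  unfold Independent
  rw [Set.forall_mem_image]
  refine forall₂_congr fun x _ => ?_
  rw [← Set.image_singleton, ← Set.image_sdiff γ.injective,
    Subgroup.closure_image_eq_orderIso hγ, Subgroup.apply_mem_orderIso_iff hγ]

theorem stronglyIndependent_image_iff
    (hγ : ∀ g, Subgroup.zpowers (γ g) = α (Subgroup.zpowers g)) (X : Set G₁) :
    StronglyIndependent (γ '' X) ↔ StronglyIndependent X := by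
  unfold StronglyIndependent
  rw [α.surjective.forall]
  refine forall_congr' fun H => ?_
  rw [Subgroup.image_subset_orderIso_iff hγ, Set.ncard_image_of_injective X γ.injective,
    dgen_orderIso hγ]

end InducedBijection

theorem index_preserving_lattice_iso_induces_complex_iso
    (G₁ G₂ : Type) [Group G₁] [Finite G₁] [Group G₂] [Finite G₂]
    (α : Subgroup G₁ ≃o Subgroup G₂)
    (hα : ∀ H : Subgroup G₁, Nat.card (α H) = Nat.card H) :
    ∃ γ : G₁ ≃ G₂,
      (∀ g : G₁, Subgroup.zpowers (γ g) = α (Subgroup.zpowers g)) ∧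
      ∀ X : Set G₁,
        (Independent X ↔ Independent (γ '' X)) ∧
        (StronglyIndependent X ↔ StronglyIndependent (γ '' X)) := by
  obtain ⟨γ, hγ⟩ := Subgroup.exists_equiv_zpowers_eq_orderIso α hα
  exact ⟨γ, hγ, fun X =>
    ⟨(independent_image_iff hγ X).symm, (stronglyIndependent_image_iff hγ X).symm⟩⟩
end

section
/- Let G be a finite abelian group and X a subset of G. For g ∈ G and a prime p, let g_p denote g^{m_p}, where m_p is the largest positive divisor of the order of g that is coprime to p (so g_p is the p-part of g). Then X is strongly independent in G if and only if there exists a prime p such that the set X_p = {x_p : x ∈ X} is strongly independent in G and |X_p| = |X|. -/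
/-- `pPart p g` is `g ^ m_p`, where `m_p` is the largest positive divisor of the
order of `g` that is coprime to `p`; i.e. the `p`-part of `g`. -/
noncomputable def pPart {G : Type*} [Group G] (p : ℕ) (g : G) : G :=
  g ^ (orderOf g / p ^ (orderOf g).factorization p)

theorem dgen_closure_le {G : Type*} [Group G] [Finite G] (S : Set G) :
    dgen (Subgroup.closure S) ≤ S.ncard :=
  Nat.sInf_le ⟨S, S.toFinite, Subgroup.subset_closure, rfl, rfl⟩

theorem exists_fin_le_closure_range_of_dgen_le {G : Type*} [Group G] [Finite G]
    {H : Subgroup G} {n : ℕ} (h : dgen H ≤ n) :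
    ∃ f : Fin n → G, H ≤ Subgroup.closure (Set.range f) := by
  have hne : {n : ℕ | ∃ S : Set G, S.Finite ∧ S ⊆ (H : Set G) ∧
      Subgroup.closure S = H ∧ S.ncard = n}.Nonempty :=
    ⟨_, H, Set.toFinite _, subset_rfl, H.closure_eq, rfl⟩
  obtain ⟨S, -, -, hSH, hS⟩ := Nat.sInf_mem hne
  have hle : Nat.card S ≤ Nat.card (Fin n) := by
    rw [Nat.card_coe_set_eq, hS, Nat.card_fin]
    exact h
  have := Fintype.ofFinite S
  obtain ⟨e⟩ : Nonempty (S ↪ Fin n) := by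
    refine Function.Embedding.nonempty_of_card_le ?_
    rwa [← Nat.card_eq_fintype_card, ← Nat.card_eq_fintype_card]
  refine ⟨Function.extend e Subtype.val 1, hSH.symm.le.trans (Subgroup.closure_mono ?_)⟩
  intro s hs
  exact ⟨e ⟨s, hs⟩, e.injective.extend_apply _ _ _⟩

theorem pow_ordCompl_card_mem_of_pPart_mem {G : Type*} [Group G] [Finite G] (p : ℕ)
    {H : Subgroup G} {x : G} (h : pPart p x ∈ H) :
    x ^ (ordCompl[p] (Nat.card G)) ∈ H := by
  obtain ⟨c, hc⟩ := Nat.ordCompl_dvd_ordCompl_of_dvd (orderOf_dvd_natCard x) p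
  rw [hc, pow_mul]
  exact H.pow_mem h c

theorem card_dvd_ordCompl_mul_ordCompl {n p q : ℕ} (hp : p.Prime) (hq : q.Prime) (hpq : p ≠ q) :
    n ∣ ordCompl[p] n * ordCompl[q] n := by
  have hcop : (ordProj[p] n).Coprime (ordProj[q] n) :=
    Nat.Coprime.pow _ _ ((Nat.coprime_primes hp hq).mpr hpq)
  have h : ordProj[p] n ∣ ordCompl[q] n := by
    refine hcop.dvd_of_dvd_mul_left ?_
    rw [Nat.ordProj_mul_ordCompl_eq_self]
    exact Nat.ordProj_dvd n p
  calc n = ordCompl[p] n * ordProj[p] n := by rw [mul_comm, Nat.ordProj_mul_ordCompl_eq_self]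
    _ ∣ _ := mul_dvd_mul_left _ h

/-- If for every prime `p` the `p`-parts of `X` lie in an `n`-generated subgroup, then `X` lies
in an `n`-generated subgroup. -/
theorem exists_fin_subset_closure_range {G : Type*} [CommGroup G] [Finite G] {X : Set G} {n : ℕ}
    (f : ℕ → Fin n → G)
    (hf : ∀ p, p.Prime → ∀ x ∈ X, pPart p x ∈ Subgroup.closure (Set.range (f p))) :
    ∃ g : Fin n → G, X ⊆ Subgroup.closure (Set.range g) := by
  set N := Nat.card G
  have hN0 : N ≠ 0 := Nat.card_pos.ne'
  let g : Fin n → G := fun i => ∏ p ∈ N.primeFactors, f p i ^ (ordCompl[p] N)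
  refine ⟨g, fun x hx => ?_⟩
  set H := Subgroup.closure (Set.range g)
  have hg : ∀ p ∈ N.primeFactors, ∀ i, g i ^ (ordCompl[p] N) = f p i ^ (ordCompl[p] N) ^ 2 := by
    intro p hp i
    rw [← Finset.prod_pow, Finset.prod_eq_single_of_mem p hp, ← pow_mul, sq]
    intro q hq hqp
    obtain ⟨c, hc⟩ := card_dvd_ordCompl_mul_ordCompl (n := N)
      (Nat.prime_of_mem_primeFactors hq) (Nat.prime_of_mem_primeFactors hp) hqp
    rw [← pow_mul, hc, pow_mul, pow_card_eq_one', one_pow]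
  have hpow : ∀ p ∈ N.primeFactors, x ^ (ordCompl[p] N) ^ 3 ∈ H := by
    intro p hp
    have hle : Subgroup.closure (Set.range (f p)) ≤
        H.comap (powMonoidHom ((ordCompl[p] N) ^ 2)) := by
      rw [Subgroup.closure_le]
      rintro _ ⟨i, rfl⟩
      change f p i ^ (ordCompl[p] N) ^ 2 ∈ H
      rw [← hg p hp i]
      exact H.pow_mem (Subgroup.subset_closure ⟨i, rfl⟩) _
    have h : (x ^ (ordCompl[p] N)) ^ (ordCompl[p] N) ^ 2 ∈ H :=
      hle (pow_ordCompl_card_mem_of_pPart_mem p (hf p (Nat.prime_of_mem_primeFactors hp) x hx))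
    rwa [← pow_mul, ← pow_succ'] at h
  rw [SetLike.mem_coe, ← QuotientGroup.eq_one_iff, ← orderOf_eq_one_iff]
  by_contra hne
  obtain ⟨p, hp, hpk⟩ := Nat.exists_prime_and_dvd hne
  have hpN : p ∣ N := hpk.trans (orderOf_dvd_of_pow_eq_one (by
    rw [← QuotientGroup.mk_pow, pow_card_eq_one', QuotientGroup.mk_one]))
  have h := hpk.trans (orderOf_dvd_of_pow_eq_one (by
    rw [← QuotientGroup.mk_pow, QuotientGroup.eq_one_iff]
    exact hpow p (Nat.mem_primeFactors.mpr ⟨hp, hpN, hN0⟩)))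
  exact Nat.not_dvd_ordCompl hp hN0 (hp.dvd_of_dvd_pow h)

theorem strongly_indep_iff_pPart_strongly_indep
    (G : Type) [CommGroup G] [Finite G] (X : Set G) :
    StronglyIndependent X ↔
      ∃ p : ℕ, p.Prime ∧ StronglyIndependent (pPart p '' X) ∧
        (pPart p '' X).ncard = X.ncard := by
  constructor
  · intro hX
    by_contra! hno
    rcases X.eq_empty_or_nonempty with rfl | hne
    · exact hno 2 Nat.prime_two (fun H _ => by simp) (by simp)
    have hcard : 0 < X.ncard := hne.ncard_pos
    have key : ∀ p : ℕ, ∃ f : Fin (X.ncard - 1) → G, p.Prime →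
        ∀ x ∈ X, pPart p x ∈ Subgroup.closure (Set.range f) := by
      intro p
      by_cases hp : p.Prime
      swap
      · exact ⟨1, fun h => absurd h hp⟩
      have hle : (pPart p '' X).ncard ≤ X.ncard := Set.ncard_image_le
      obtain ⟨H, hXH, hH⟩ : ∃ H : Subgroup G, pPart p '' X ⊆ H ∧ dgen H < X.ncard := by
        by_cases hs : StronglyIndependent (pPart p '' X)
        · exact ⟨_, Subgroup.subset_closure,
            (dgen_closure_le _).trans_lt (lt_of_le_of_ne hle (hno p hp hs))⟩
        · simp only [StronglyIndependent, not_forall, not_le] at hs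
          obtain ⟨H, hXH, hH⟩ := hs
          exact ⟨H, hXH, hH.trans_le hle⟩
      obtain ⟨f, hf⟩ := exists_fin_le_closure_range_of_dgen_le (Nat.le_sub_one_of_lt hH)
      exact ⟨f, fun _ x hx => hf (hXH ⟨x, hx, rfl⟩)⟩
    choose f hf using key
    obtain ⟨g, hg⟩ := exists_fin_subset_closure_range f hf
    have h₁ : (Set.range g).ncard ≤ X.ncard - 1 := by
      rw [← Set.image_univ]
      exact (Set.ncard_image_le Set.finite_univ).trans (by simp [Set.ncard_univ])
    have h₂ := (hX _ hg).trans (dgen_closure_le _)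
    omega
  · rintro ⟨p, -, hs, hcard⟩ H hXH
    rw [← hcard]
    refine hs H ?_
    rintro _ ⟨x, hx, rfl⟩
    exact H.pow_mem (hXH hx) _
end

section
/- Let p be a prime and let G be a finite noncyclic abelian p-group. For x ∈ G let N(x) = {x} ∪ {z ∈ G : z ≠ x and (x ∈ ⟨z⟩ or z ∈ ⟨x⟩)} denote the closed neighborhood of x in the power graph of G. Then for all x, y ∈ G, N(x) = N(y) if and only if ⟨x⟩ = ⟨y⟩. -/
/-- In a `p`-group, a power of `b` that does not generate `⟨b⟩` is a `p`-th power
in `⟨b⟩`. -/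
theorem IsPGroup.exists_eq_zpow_pow_of_mem_zpowers {p : ℕ} (hp : p.Prime) {G : Type*} [Group G]
    (hG : IsPGroup p G) {a b : G} (hab : a ∈ Subgroup.zpowers b)
    (hba : b ∉ Subgroup.zpowers a) : ∃ j : ℤ, a = (b ^ j) ^ p := by
  obtain ⟨k, rfl⟩ := Subgroup.mem_zpowers_iff.mp hab
  by_cases hk : (p : ℤ) ∣ k
  · obtain ⟨c, rfl⟩ := hk
    exact ⟨c, by rw [← zpow_natCast, ← zpow_mul, mul_comm]⟩
  · obtain ⟨n, hn⟩ := hG b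
    have hcop : IsCoprime k ((p : ℤ) ^ n) :=
      (((Nat.prime_iff_prime_int.mp hp).coprime_iff_not_dvd.mpr hk).symm).pow_right
    obtain ⟨u, v, huv⟩ := hcop
    refine absurd (Subgroup.mem_zpowers_iff.mpr ⟨u, ?_⟩) hba
    have hb : b ^ ((p : ℤ) ^ n) = 1 := by exact_mod_cast hn
    calc (b ^ k) ^ u = b ^ (u * k + v * (p : ℤ) ^ n) := by
          rw [zpow_add, mul_comm v, zpow_mul b (_ ^ n), hb, one_zpow, mul_one, mul_comm, zpow_mul]
      _ = b := by rw [huv, zpow_one]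

/-- In a finite noncyclic abelian `p`-group, no cyclic subgroup contains all the elements
of order `p`. -/
theorem IsPGroup.exists_pow_eq_one_notMem_zpowers {p : ℕ} (hp : p.Prime) {G : Type*}
    [CommGroup G] [Finite G] (hG : IsPGroup p G) (hnc : ¬ IsCyclic G) (x : G) :
    ∃ z : G, z ^ p = 1 ∧ z ∉ Subgroup.zpowers x := by
  obtain ⟨b, hxb, hmax⟩ := (Set.toFinite {b : G | x ∈ Subgroup.zpowers b}).exists_maximalFor
    Subgroup.zpowers _ ⟨x, Subgroup.mem_zpowers x⟩
  have hxb' : Subgroup.zpowers x ≤ Subgroup.zpowers b := Subgroup.zpowers_le.mpr hxb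
  obtain ⟨g, hg, hgp⟩ : ∃ g : G, g ∉ Subgroup.zpowers b ∧ g ^ p ∈ Subgroup.zpowers b := by
    by_contra! h
    refine hnc ⟨b, fun g => ?_⟩
    by_contra hg
    have hpow : ∀ n : ℕ, g ^ p ^ n ∉ Subgroup.zpowers b := by
      intro n
      induction n with
      | zero => rwa [pow_zero, pow_one]
      | succ n ih => rw [pow_succ, pow_mul]; exact h _ ih
    obtain ⟨n, hn⟩ := hG g
    exact hpow n (hn ▸ one_mem _)
  have hbg : b ∉ Subgroup.zpowers (g ^ p) := fun hb => by
    have hle : Subgroup.zpowers b ≤ Subgroup.zpowers g := Subgroup.zpowers_le.mpr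
      (Subgroup.zpowers_le.mpr (Subgroup.npow_mem_zpowers g p) hb)
    exact hg (hmax (hle hxb) hle (Subgroup.mem_zpowers g))
  obtain ⟨j, hj⟩ := hG.exists_eq_zpow_pow_of_mem_zpowers hp hgp hbg
  refine ⟨g * (b ^ j)⁻¹, by rw [mul_pow, inv_pow, hj, mul_inv_cancel], fun hz => hg ?_⟩
  exact (Subgroup.mul_mem_cancel_right _
    (inv_mem (Subgroup.zpow_mem_zpowers b j))).mp (hxb' hz)

/-- In a finite noncyclic abelian `p`-group, if `y ∈ ⟨x⟩` and every `w` with `y ∈ ⟨w⟩` is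
comparable with `x`, then `x ∈ ⟨y⟩`. -/
theorem IsPGroup.mem_zpowers_of_forall_comparable {p : ℕ} (hp : p.Prime) {G : Type*}
    [CommGroup G] [Finite G] (hG : IsPGroup p G) (hnc : ¬ IsCyclic G) {x y : G}
    (hyx : y ∈ Subgroup.zpowers x)
    (h : ∀ w : G, y ∈ Subgroup.zpowers w → x ∈ Subgroup.zpowers w ∨ w ∈ Subgroup.zpowers x) :
    x ∈ Subgroup.zpowers y := by
  by_contra hxy
  obtain ⟨j, hj⟩ := hG.exists_eq_zpow_pow_of_mem_zpowers hp hyx hxy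
  obtain ⟨z, hz, hzx⟩ := hG.exists_pow_eq_one_notMem_zpowers hp hnc x
  have hwp : (x ^ j * z) ^ p = y := by rw [mul_pow, hz, mul_one, hj]
  have hwx : x ^ j * z ∉ Subgroup.zpowers x := fun hw =>
    hzx ((Subgroup.mul_mem_cancel_left _ (Subgroup.zpow_mem_zpowers x j)).mp hw)
  rcases h (x ^ j * z) (hwp ▸ Subgroup.npow_mem_zpowers _ p) with hxw | hw
  · obtain ⟨i, hi⟩ := hG.exists_eq_zpow_pow_of_mem_zpowers hp hxw hwx
    refine hxy (Subgroup.mem_zpowers_iff.mpr ⟨i, ?_⟩)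
    rw [hi, ← hwp, ← zpow_natCast, ← zpow_natCast, ← zpow_mul, ← zpow_mul, mul_comm i]
  · exact hwx hw

/-- Membership in the closed neighborhood of `x` in the power graph. -/
theorem mem_powerGraph_closedNbhd_iff {G : Type*} [Group G] (x z : G) :
    z ∈ ({x} ∪ {z : G | z ≠ x ∧ (x ∈ Subgroup.zpowers z ∨ z ∈ Subgroup.zpowers x)} : Set G) ↔
      x ∈ Subgroup.zpowers z ∨ z ∈ Subgroup.zpowers x := by
  by_cases hz : z = x <;> simp [hz]

theorem power_graph_closed_nbhd_eq_iff_same_cyclic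
    (p : ℕ) (hp : p.Prime) (G : Type) [CommGroup G] [Finite G]
    (hpG : IsPGroup p G) (hnc : ¬ IsCyclic G) (x y : G) :
    ({x} ∪ {z : G | z ≠ x ∧ (x ∈ Subgroup.zpowers z ∨ z ∈ Subgroup.zpowers x)} =
       {y} ∪ {z : G | z ≠ y ∧ (y ∈ Subgroup.zpowers z ∨ z ∈ Subgroup.zpowers y)}) ↔
      Subgroup.zpowers x = Subgroup.zpowers y := by
  simp only [Set.ext_iff, mem_powerGraph_closedNbhd_iff]
  constructor
  · intro h
    rcases (h x).mp (Or.inl (Subgroup.mem_zpowers x)) with hyx | hxy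
    · exact le_antisymm (Subgroup.zpowers_le.mpr
        (hpG.mem_zpowers_of_forall_comparable hp hnc hyx fun w hw => (h w).mpr (Or.inl hw)))
        (Subgroup.zpowers_le.mpr hyx)
    · exact le_antisymm (Subgroup.zpowers_le.mpr hxy) (Subgroup.zpowers_le.mpr
        (hpG.mem_zpowers_of_forall_comparable hp hnc hxy fun w hw => (h w).mp (Or.inl hw)))
  · intro h z
    rw [← Subgroup.zpowers_le (g := x), ← Subgroup.zpowers_le (g := y), h]
end
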